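/- Let F = x²z³ − 2xy²z² + y⁴z − 72x²yz + 8xy³ − 432x³ ∈ R and let Q = R[W]/(W² − F), where R[W] = R^[1]. Then the group Aut_k(Q) of k-algebra automorphisms of Q is isomorphic to k*. -/

import Mathlib

open MvPolynomial

set_option synthInstance.maxHeartbeats 400000
set_option maxHeartbeats 1000000

noncomputable section

/-- The polynomial `F = x²z³ - 2xy²z² + y⁴z - 72x²yz + 8xy³ - 432x³` (with `x = X 0`,
`y = X 1`, `z = X 2`). -/
def cayleyF (k : Type) [Field k] : MvPolynomial (Fin 3) k :=
  X 0 ^ 2 * X 2 ^ 3 - C 2 * X 0 * X 1 ^ 2 * X 2 ^ 2 + X 1 ^ 4 * X 2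
    - C 72 * X 0 ^ 2 * X 1 * X 2 + C 8 * X 0 * X 1 ^ 3 - C 432 * X 0 ^ 3

/-- The ring of invariants `Q = R[W]/(W² - F)` of the binary quintic representation,
where `R[W] = k[x,y,z,W]` is modelled as `MvPolynomial (Fin 4) k` with `W = X 3`. -/
abbrev QuinticInvariantRing (k : Type) [Field k] : Type :=
  MvPolynomial (Fin 4) k ⧸
    Ideal.span {(X 3 : MvPolynomial (Fin 4) k) ^ 2 - rename Fin.castSucc (cayleyF k)}

set_option linter.unusedSectionVars false
open Polynomial in
theorem sing_pts {K : Type*} [CommRing K] [IsDomain K] [CharZero K] (x y z : K)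
    (h1 : 2*x*z^3-2*y^2*z^2-144*x*y*z+8*y^3-1296*x^2 = 0)
    (h2 : -x*y*z^2+y^3*z-18*x^2*z+6*x*y^2=0)
    (h3 : 3*x^2*z^2-4*x*y^2*z+y^4-72*x^2*y=0) (hz : z ≠ 0) :
    (x = 0 ∧ y = 0) ∨ (135*x+18*y*z-z^3 = 0 ∧ 3*y-z^2=0) := by
  have h : x^4 * (27 * x + z^3)^2 = 0 := by grind
  rcases mul_eq_zero.1 h with h | h
  · have hx : x = 0 := by simpa using h
    subst hx
    left
    refine ⟨rfl, ?_⟩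
    have : y^4 = 0 := by linear_combination h3
    simpa using this
  · right
    have h : 27 * x + z^3 = 0 := by simpa using h
    have h4 : z^6 * (3*y-z^2) = 0 := by grind
    have h5 : 3*y-z^2 = 0 := by simpa [hz] using h4
    refine ⟨?_, h5⟩
    linear_combination 5 * h + 6 * z * h5

section core
open Polynomial

variable {k A : Type*} [CommRing k] [CommRing A] [IsDomain A] [CharZero A] [Algebra k A]

/-- Jacobian determinant of three elements with respect to three derivations. -/
def jac3 (d1 d2 d3 : Derivation k A[X] A[X]) (f g h : A[X]) : A[X] :=
  d1 f * (d2 g * d3 h - d3 g * d2 h) - d2 f * (d1 g * d3 h - d3 g * d1 h)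
    + d3 f * (d1 g * d2 h - d2 g * d1 h)

theorem jac3_deg (d1 d2 d3 : Derivation k A[X] A[X])
    (h1 : ∀ p, (d1 p).natDegree ≤ p.natDegree)
    (h2 : ∀ p, (d2 p).natDegree ≤ p.natDegree)
    (h3 : ∀ p, (d3 p).natDegree ≤ p.natDegree) (f g h : A[X]) :
    (jac3 d1 d2 d3 f g h).natDegree ≤ f.natDegree + g.natDegree + h.natDegree := by
  have key : ∀ (d d' d'' : Derivation k A[X] A[X]), (∀ p, (d p).natDegree ≤ p.natDegree) →
    (∀ p, (d' p).natDegree ≤ p.natDegree) → (∀ p, (d'' p).natDegree ≤ p.natDegree) →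
    (d f * (d' g * d'' h - d'' g * d' h)).natDegree
      ≤ f.natDegree + g.natDegree + h.natDegree := by
    intro d d' d'' h1 h2 h3
    have a1 := natDegree_mul_le_of_le (h2 g) (h3 h)
    have a2 := natDegree_mul_le_of_le (h3 g) (h2 h)
    have a3 := natDegree_sub_le_of_le a1 a2
    have a4 := natDegree_mul_le_of_le (h1 f) a3
    simp only [max_self] at a4
    omega
  have := natDegree_add_le_of_le (natDegree_sub_le_of_le (key d1 d2 d3 h1 h2 h3)
    (key d2 d1 d3 h2 h1 h3)) (key d3 d1 d2 h3 h1 h2)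
  simpa [jac3] using this

/-- the polynomial F -/
def FF {B : Type*} [CommRing B] (x y z : B) : B :=
  x^2*z^3 - 2*x*y^2*z^2 + y^4*z - 72*x^2*y*z + 8*x*y^3 - 432*x^3

/-- a monomial term -/
def TT (p q r : A[X]) (n : ℤ) (i j l : ℕ) : A[X] := (n : A[X]) * p^i * q^j * r^l

theorem TT_le (p q r : A[X]) (n : ℤ) (i j l : ℕ) :
    (TT p q r n i j l).natDegree ≤ i * p.natDegree + j * q.natDegree + l * r.natDegree := by
  have a1 := natDegree_mul_le_of_le (natDegree_intCast (R := A) n).le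
    (natDegree_pow_le (p := p) (n := i))
  have a2 := natDegree_mul_le_of_le a1 (natDegree_pow_le (p := q) (n := j))
  have a3 := natDegree_mul_le_of_le a2 (natDegree_pow_le (p := r) (n := l))
  unfold TT
  omega

theorem TT_eq (p q r : A[X]) (n : ℤ) (i j l : ℕ) (hn : n ≠ 0) (hp : p ≠ 0) (hq : q ≠ 0)
    (hr : l = 0 ∨ r ≠ 0) :
    (TT p q r n i j l).natDegree = i * p.natDegree + j * q.natDegree + l * r.natDegree := by
  have hn' : (n : A[X]) ≠ 0 := by exact_mod_cast hn
  unfold TT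
  rcases hr with rfl | hr
  · rw [pow_zero, mul_one, natDegree_mul (mul_ne_zero hn' (pow_ne_zero _ hp)) (pow_ne_zero _ hq),
      natDegree_mul hn' (pow_ne_zero _ hp)]
    simp
  · rw [natDegree_mul (mul_ne_zero (mul_ne_zero hn' (pow_ne_zero _ hp)) (pow_ne_zero _ hq))
      (pow_ne_zero _ hr), natDegree_mul (mul_ne_zero hn' (pow_ne_zero _ hp)) (pow_ne_zero _ hq),
      natDegree_mul hn' (pow_ne_zero _ hp)]
    simp

theorem dom_add {p q : A[X]} {N : ℕ} (hp : p.natDegree = N) (hq : q.natDegree < N) :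
    (p + q).natDegree = N := by
  rw [natDegree_add_eq_left_of_natDegree_lt (by omega), hp]

theorem TT_lt (p q r : A[X]) (n : ℤ) (i j l N : ℕ)
    (h : i * p.natDegree + j * q.natDegree + l * r.natDegree < N) :
    (TT p q r n i j l).natDegree < N := (TT_le p q r n i j l).trans_lt h

theorem add_lt' {p q : A[X]} {N : ℕ} (hp : p.natDegree < N) (hq : q.natDegree < N) :
    (p + q).natDegree < N := (natDegree_add_le p q).trans_lt (max_lt hp hq)

theorem der_lit2 (d : Derivation k A[X] A[X]) : d (2 : A[X]) = 0 := by
  exact_mod_cast d.map_natCast 2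

theorem der_lit3 (d : Derivation k A[X] A[X]) : d (3 : A[X]) = 0 := by
  exact_mod_cast d.map_natCast 3

theorem der_lit8 (d : Derivation k A[X] A[X]) : d (8 : A[X]) = 0 := by
  exact_mod_cast d.map_natCast 8

theorem der_lit18 (d : Derivation k A[X] A[X]) : d (18 : A[X]) = 0 := by
  exact_mod_cast d.map_natCast 18

theorem der_lit72 (d : Derivation k A[X] A[X]) : d (72 : A[X]) = 0 := by
  exact_mod_cast d.map_natCast 72

theorem der_lit135 (d : Derivation k A[X] A[X]) : d (135 : A[X]) = 0 := by
  exact_mod_cast d.map_natCast 135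

theorem der_lit432 (d : Derivation k A[X] A[X]) : d (432 : A[X]) = 0 := by
  exact_mod_cast d.map_natCast 432

theorem jac3_Fx (d1 d2 d3 : Derivation k A[X] A[X]) (x y z : A[X]) :
    jac3 d1 d2 d3 (FF x y z) y z = (2*x*z^3-2*y^2*z^2-144*x*y*z+8*y^3-1296*x^2)
      * jac3 d1 d2 d3 x y z := by
  simp only [jac3, FF, map_sub, map_add, Derivation.leibniz, Derivation.leibniz_pow, smul_eq_mul,
    nsmul_eq_mul, der_lit2, der_lit72, der_lit8, der_lit432]
  push_cast
  ring

theorem jac3_Fy (d1 d2 d3 : Derivation k A[X] A[X]) (x y z : A[X]) :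
    jac3 d1 d2 d3 x (FF x y z) z = (4 * (-x*y*z^2+y^3*z-18*x^2*z+6*x*y^2))
      * jac3 d1 d2 d3 x y z := by
  simp only [jac3, FF, map_sub, map_add, Derivation.leibniz, Derivation.leibniz_pow, smul_eq_mul,
    nsmul_eq_mul, der_lit2, der_lit72, der_lit8, der_lit432]
  push_cast
  ring

theorem jac3_Fz (d1 d2 d3 : Derivation k A[X] A[X]) (x y z : A[X]) :
    jac3 d1 d2 d3 x y (FF x y z) = (3*x^2*z^2-4*x*y^2*z+y^4-72*x^2*y)
      * jac3 d1 d2 d3 x y z := by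
  simp only [jac3, FF, map_sub, map_add, Derivation.leibniz, Derivation.leibniz_pow, smul_eq_mul,
    nsmul_eq_mul, der_lit2, der_lit72, der_lit8, der_lit432]
  push_cast
  ring

variable (d1 d2 d3 : Derivation k A[X] A[X]) (h1 : ∀ p, (d1 p).natDegree ≤ p.natDegree)
    (h2 : ∀ p, (d2 p).natDegree ≤ p.natDegree)
    (h3 : ∀ p, (d3 p).natDegree ≤ p.natDegree)

include h1 h2 h3

theorem core_A4 (x y z : A[X]) (hJ : 6 ≤ (jac3 d1 d2 d3 x y z).natDegree)
    (hb : 6 ∣ y.natDegree) (hc : 6 ∣ z.natDegree) (hz : 0 < z.natDegree)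
    (ha' : x.natDegree < 3 * z.natDegree) (hb' : y.natDegree < 2 * z.natDegree)
    (hF : (FF x y z).natDegree ≤ 12) : False := by
  have hJ0 : jac3 d1 d2 d3 x y z ≠ 0 := by rintro h; simp [h] at hJ
  have hz0 : z ≠ 0 := by rintro rfl; simp at hz
  obtain ⟨u, hu⟩ : ∃ u, u = x * z - y^2 := ⟨_, rfl⟩
  have e1 : jac3 d1 d2 d3 u y z = z * jac3 d1 d2 d3 x y z := by
    simp only [jac3, hu, map_sub, Derivation.leibniz, Derivation.leibniz_pow, smul_eq_mul]
    simp
    ring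
  have e2 := jac3_Fx d1 d2 d3 x y z
  have hu0 : u ≠ 0 := by
    rintro rfl
    have : z * jac3 d1 d2 d3 x y z = 0 := by rw [← e1]; simp [jac3]
    exact mul_ne_zero hz0 hJ0 this
  have hed : u.natDegree < 4 * z.natDegree := by
    have h := natDegree_sub_le_of_le (natDegree_mul_le (p := x) (q := z))
      (natDegree_pow_le (p := y) (n := 2))
    rw [← hu] at h
    refine h.trans_lt (max_lt ?_ ?_) <;> omega
  have b1 : 6 ≤ u.natDegree + y.natDegree := by
    have := jac3_deg d1 d2 d3 h1 h2 h3 u y z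
    rw [e1, natDegree_mul hz0 hJ0] at this
    omega
  have hF3 : (z^3 * FF x y z).natDegree ≤ 3 * z.natDegree + 12 := by
    refine (natDegree_mul_le_of_le (natDegree_pow_le (p := z) (n := 3)) hF)
  have eF : z^3 * FF x y z = TT z u y 1 4 2 0 + (TT z u y (-64) 2 0 5 + (TT z u y (-72) 2 2 1 +
      (TT z u y (-136) 2 1 3 + (TT z u y (-432) 0 3 0 + (TT z u y (-1296) 0 2 2 +
      (TT z u y (-1296) 0 1 4 + TT z u y (-432) 0 0 6)))))) := by
    simp only [FF, TT, hu]; push_cast; ring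
  rcases lt_trichotomy (5 * y.natDegree) (2 * z.natDegree + 2 * u.natDegree) with h | h | h
  · have : (z^3 * FF x y z).natDegree = 4 * z.natDegree + 2 * u.natDegree := by
      rw [eF]
      refine dom_add ?_ ?_
      · rw [TT_eq _ _ _ _ _ _ _ (by norm_num) hz0 hu0 (Or.inl rfl)]; ring
      · iterate 6 refine add_lt' (TT_lt _ _ _ _ _ _ _ _ (by omega)) ?_
        exact TT_lt _ _ _ _ _ _ _ _ (by omega)
    omega
  · have e3 : z^2 * (2*x*z^3-2*y^2*z^2-144*x*y*z+8*y^3-1296*x^2) =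
        TT z u y 2 4 1 0 + (TT z u y (-144) 2 1 1 +
      (TT z u y (-136) 2 0 3 + (TT z u y (-1296) 0 2 0 + (TT z u y (-2592) 0 1 2 +
      (TT z u y (-1296) 0 0 4))))) := by
      simp only [TT, hu]; push_cast; ring
    have e4 : (z^2 * (2*x*z^3-2*y^2*z^2-144*x*y*z+8*y^3-1296*x^2)).natDegree
        = 4 * z.natDegree + u.natDegree := by
      rw [e3]
      refine dom_add ?_ ?_
      · rw [TT_eq _ _ _ _ _ _ _ (by norm_num) hz0 hu0 (Or.inl rfl)]; ring
      · iterate 4 refine add_lt' (TT_lt _ _ _ _ _ _ _ _ (by omega)) ?_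
        exact TT_lt _ _ _ _ _ _ _ _ (by omega)
    have hne : z^2 * (2*x*z^3-2*y^2*z^2-144*x*y*z+8*y^3-1296*x^2) ≠ 0 := by
      intro h; rw [h] at e4; simp at e4; omega
    have e5 := jac3_deg d1 d2 d3 h1 h2 h3 (FF x y z) y z
    have e6 : (z^2 * (2*x*z^3-2*y^2*z^2-144*x*y*z+8*y^3-1296*x^2) *
      jac3 d1 d2 d3 x y z).natDegree ≤ 2 * z.natDegree + (12 + y.natDegree + z.natDegree) := by
      rw [mul_assoc, ← e2]
      refine (natDegree_mul_le_of_le (natDegree_pow_le (p := z) (n := 2)) ?_)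
      omega
    rw [natDegree_mul hne hJ0, e4] at e6
    omega
  · have hy0 : y ≠ 0 := by rintro rfl; simp at h
    have : (z^3 * FF x y z).natDegree = 2 * z.natDegree + 5 * y.natDegree := by
      rw [eF, add_left_comm]
      refine dom_add ?_ ?_
      · rw [TT_eq _ _ _ _ _ _ _ (by norm_num) hz0 hu0 (Or.inr hy0)]; ring
      · iterate 6 refine add_lt' (TT_lt _ _ _ _ _ _ _ _ (by omega)) ?_
        exact TT_lt _ _ _ _ _ _ _ _ (by omega)
    omega

theorem core_A2 (x y z : A[X]) (hJ : 6 ≤ (jac3 d1 d2 d3 x y z).natDegree)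
    (hz : 6 ≤ z.natDegree)
    (ha' : (135*x+18*y*z-z^3).natDegree < 3 * z.natDegree)
    (hb' : (3*y-z^2).natDegree < 2 * z.natDegree)
    (hF : (FF x y z).natDegree ≤ 12) : False := by
  have hJ0 : jac3 d1 d2 d3 x y z ≠ 0 := by rintro h; simp [h] at hJ
  have hz0 : z ≠ 0 := by rintro rfl; simp at hz
  obtain ⟨u, hu⟩ : ∃ u, u = 135*x+18*y*z-z^3 := ⟨_, rfl⟩
  obtain ⟨v, hv⟩ : ∃ v, v = 3*y-z^2 := ⟨_, rfl⟩
  rw [← hu] at ha'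
  rw [← hv] at hb'
  have e1 : jac3 d1 d2 d3 u v z = 405 * jac3 d1 d2 d3 x y z := by
    simp only [jac3, hu, hv, map_sub, map_add, Derivation.leibniz, Derivation.leibniz_pow,
      smul_eq_mul, nsmul_eq_mul, der_lit3, der_lit135, der_lit18]
    push_cast
    ring
  have e2 : 30375 * jac3 d1 d2 d3 (FF x y z) v z = (250*u*z^3+162*v^2*z^2+200*v^3+336*u*v*z-48*u^2)
      * (135 * jac3 d1 d2 d3 x y z) := by
    have : jac3 d1 d2 d3 (FF x y z) v z = 3 * jac3 d1 d2 d3 (FF x y z) y z := by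
      simp only [jac3, hv, map_sub, map_add, Derivation.leibniz, Derivation.leibniz_pow,
        smul_eq_mul, nsmul_eq_mul, der_lit3]
      push_cast
      ring
    rw [this, jac3_Fx, hu, hv]
    ring
  have hu0 : u ≠ 0 := by
    intro h
    have h' : jac3 d1 d2 d3 u v z = 0 := by rw [h]; simp [jac3]
    rw [h'] at e1
    exact mul_ne_zero (by norm_num) hJ0 e1.symm
  have nlit : ∀ n : ℕ, n ≠ 0 → ∀ p : A[X], ((n : A[X]) * p).natDegree = p.natDegree := by
    intro n hn p
    rcases eq_or_ne p 0 with rfl | hp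
    · simp
    · rw [natDegree_mul (by exact_mod_cast hn) hp]; simp
  have hF3 : (91125 * FF x y z).natDegree ≤ 12 := by
    have := nlit 91125 (by norm_num) (FF x y z)
    push_cast at this
    rw [this]; exact hF
  have eF : 91125 * FF x y z = TT z u v 125 3 2 0 + (TT z u v (-64) 3 0 3 + (TT z u v (-75) 1 0 4 +
      (TT z u v 162 2 1 2 + (TT z u v 200 0 1 3 + (TT z u v 168 1 2 1 +
      (TT z u v (-16) 0 3 0)))))) := by
    simp only [FF, TT, hu, hv]; push_cast; ring
  rcases lt_trichotomy (3 * v.natDegree) (2 * u.natDegree) with h | h | h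
  · have : (91125 * FF x y z).natDegree = 3 * z.natDegree + 2 * u.natDegree := by
      rw [eF]
      refine dom_add ?_ ?_
      · rw [TT_eq _ _ _ _ _ _ _ (by norm_num) hz0 hu0 (Or.inl rfl)]; ring
      · iterate 5 refine add_lt' (TT_lt _ _ _ _ _ _ _ _ (by omega)) ?_
        exact TT_lt _ _ _ _ _ _ _ _ (by omega)
    omega
  · have e3 : (250*u*z^3+162*v^2*z^2+200*v^3+336*u*v*z-48*u^2) =
        TT z u v 250 3 1 0 + (TT z u v 162 2 0 2 +
      (TT z u v 200 0 0 3 + (TT z u v 336 1 1 1 + (TT z u v (-48) 0 2 0)))) := by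
      simp only [TT]; push_cast; ring
    have e4 : (250*u*z^3+162*v^2*z^2+200*v^3+336*u*v*z-48*u^2).natDegree
        = 3 * z.natDegree + u.natDegree := by
      rw [e3]
      refine dom_add ?_ ?_
      · rw [TT_eq _ _ _ _ _ _ _ (by norm_num) hz0 hu0 (Or.inl rfl)]; ring
      · iterate 3 refine add_lt' (TT_lt _ _ _ _ _ _ _ _ (by omega)) ?_
        exact TT_lt _ _ _ _ _ _ _ _ (by omega)
    have hne : (250*u*z^3+162*v^2*z^2+200*v^3+336*u*v*z-48*u^2) ≠ 0 := by
      intro h; rw [h] at e4; simp at e4; omega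
    have e5 := jac3_deg d1 d2 d3 h1 h2 h3 (FF x y z) v z
    have n1 := nlit 30375 (by norm_num) (jac3 d1 d2 d3 (FF x y z) v z)
    have n2 := nlit 135 (by norm_num) (jac3 d1 d2 d3 x y z)
    push_cast at n1 n2
    rw [e2, natDegree_mul hne (mul_ne_zero (by norm_num) hJ0), e4, n2] at n1
    omega
  · have hv0 : v ≠ 0 := by rintro rfl; simp at h
    have : (91125 * FF x y z).natDegree = 3 * z.natDegree + 3 * v.natDegree := by
      rw [eF, add_left_comm]
      refine dom_add ?_ ?_
      · rw [TT_eq _ _ _ _ _ _ _ (by norm_num) hz0 hu0 (Or.inr hv0)]; ring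
      · iterate 5 refine add_lt' (TT_lt _ _ _ _ _ _ _ _ (by omega)) ?_
        exact TT_lt _ _ _ _ _ _ _ _ (by omega)
    omega

omit h1 h2 h3 in
theorem coeff_lc (p q : A[X]) (m n : ℕ) (hp : p.natDegree ≤ m) (hq : q.natDegree ≤ n) :
    (p*q).natDegree ≤ m + n ∧ (p * q).coeff (m+n) = p.coeff m * q.coeff n :=
  ⟨natDegree_mul_le_of_le hp hq, coeff_mul_add_eq_of_natDegree_le hp hq⟩

/-- `p` has degree at most `m` with coefficient `a` there -/
def LC (p : A[X]) (m : ℕ) (a : A) : Prop := p.natDegree ≤ m ∧ p.coeff m = a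

omit h1 h2 h3 [IsDomain A] [CharZero A] in
theorem LC.mul {p q : A[X]} {m n : ℕ} {a b : A} (hp : LC p m a) (hq : LC q n b) :
    LC (p*q) (m+n) (a*b) :=
  ⟨natDegree_mul_le_of_le hp.1 hq.1, by
    rw [coeff_mul_add_eq_of_natDegree_le hp.1 hq.1, hp.2, hq.2]⟩

omit h1 h2 h3 [IsDomain A] [CharZero A] in
theorem LC.pow {p : A[X]} {m : ℕ} {a : A} (hp : LC p m a) (n : ℕ) :
    LC (p^n) (n*m) (a^n) := ⟨natDegree_pow_le_of_le n hp.1, by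
    rw [coeff_pow_of_natDegree_le hp.1, hp.2]⟩

omit h1 h2 h3 [IsDomain A] [CharZero A] in
theorem LC.add {p q : A[X]} {m : ℕ} {a b : A} (hp : LC p m a) (hq : LC q m b) :
    LC (p+q) m (a+b) := ⟨by simpa using natDegree_add_le_of_le hp.1 hq.1, by
      rw [Polynomial.coeff_add, hp.2, hq.2]⟩

omit h1 h2 h3 [IsDomain A] [CharZero A] in
theorem LC_TT {x y z : A[X]} {a b c m : ℕ} {x0 y0 z0 : A} (hx : LC x a x0) (hy : LC y b y0)
    (hz : LC z c z0) (n : ℤ) (i j l : ℕ) (h : m = i*a+j*b+l*c) :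
    LC (TT x y z n i j l) m ((n:A)*x0^i*y0^j*z0^l) := by
  have h0 : LC (n : A[X]) 0 (n : A) := ⟨by simp, by simp⟩
  have := ((h0.mul (hx.pow i)).mul (hy.pow j)).mul (hz.pow l)
  rw [h]
  simpa [TT] using this

theorem core_main (x y z : A[X]) (hJ : 6 ≤ (jac3 d1 d2 d3 x y z).natDegree)
    (ha : 6 ∣ x.natDegree)
    (hb : 6 ∣ y.natDegree) (hc : 6 ∣ z.natDegree)
    (hF : (FF x y z).natDegree ≤ 12) : False := by
  have hJ0 : jac3 d1 d2 d3 x y z ≠ 0 := by rintro h; simp [h] at hJ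
  have hJd := jac3_deg d1 d2 d3 h1 h2 h3 x y z
  obtain ⟨m, hxm, hym, hzm, hm⟩ : ∃ m : ℕ, x.natDegree ≤ 3 * m ∧ y.natDegree ≤ 2 * m ∧
      z.natDegree ≤ m ∧ (x.natDegree = 3 * m ∨ y.natDegree = 2 * m ∨ z.natDegree = m) := by
    obtain ⟨a, ha⟩ := ha
    obtain ⟨b, hb⟩ := hb
    obtain ⟨c, hc⟩ := hc
    refine ⟨max (2*a) (max (3*b) (6*c)), ?_⟩
    omega
  have hm2 : 2 ≤ m := by omega
  have Lx : LC x (3*m) (x.coeff (3*m)) := ⟨hxm, rfl⟩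
  have Ly : LC y (2*m) (y.coeff (2*m)) := ⟨hym, rfl⟩
  have Lz : LC z m (z.coeff m) := ⟨hzm, rfl⟩
  have hne : ¬ (x.coeff (3*m) = 0 ∧ y.coeff (2*m) = 0 ∧ z.coeff m = 0) := by
    rintro ⟨e1, e2, e3⟩
    rcases hm with h | h | h
    · rw [← h, coeff_natDegree, leadingCoeff_eq_zero] at e1
      rw [e1] at h; simp at h; omega
    · rw [← h, coeff_natDegree, leadingCoeff_eq_zero] at e2
      rw [e2] at h; simp at h; omega
    · rw [← h, coeff_natDegree, leadingCoeff_eq_zero] at e3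
      rw [e3] at h; simp at h; omega
  set x0 := x.coeff (3*m) with hx0
  set y0 := y.coeff (2*m) with hy0
  set z0 := z.coeff m with hz0
  have LT := fun n i j l M h => LC_TT (m := M) Lx Ly Lz n i j l h
  have LF : LC (FF x y z) (9*m) (FF x0 y0 z0) := by
    have := (LT 1 2 0 3 (9*m) (by ring)).add ((LT (-2) 1 2 2 (9*m) (by ring)).add
      ((LT 1 0 4 1 (9*m) (by ring)).add ((LT (-72) 2 1 1 (9*m) (by ring)).add
      ((LT 8 1 3 0 (9*m) (by ring)).add (LT (-432) 3 0 0 (9*m) (by ring))))))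
    convert this using 1
    · simp only [FF, TT]; push_cast; ring
    · simp only [FF]; push_cast; ring
  have LFx : LC (2*x*z^3-2*y^2*z^2-144*x*y*z+8*y^3-1296*x^2) (6*m)
      (2*x0*z0^3-2*y0^2*z0^2-144*x0*y0*z0+8*y0^3-1296*x0^2) := by
    have := (LT 2 1 0 3 (6*m) (by ring)).add ((LT (-2) 0 2 2 (6*m) (by ring)).add
      ((LT (-144) 1 1 1 (6*m) (by ring)).add ((LT 8 0 3 0 (6*m) (by ring)).add
      (LT (-1296) 2 0 0 (6*m) (by ring)))))
    convert this using 1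
    · simp only [TT]; push_cast; ring
    · push_cast; ring
  have LFy : LC (4 * (-x*y*z^2+y^3*z-18*x^2*z+6*x*y^2)) (7*m)
      (4 * (-x0*y0*z0^2+y0^3*z0-18*x0^2*z0+6*x0*y0^2)) := by
    have := (LT (-4) 1 1 2 (7*m) (by ring)).add ((LT 4 0 3 1 (7*m) (by ring)).add
      ((LT (-72) 2 0 1 (7*m) (by ring)).add (LT 24 1 2 0 (7*m) (by ring))))
    convert this using 1
    · simp only [TT]; push_cast; ring
    · push_cast; ring
  have LFz : LC (3*x^2*z^2-4*x*y^2*z+y^4-72*x^2*y) (8*m)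
      (3*x0^2*z0^2-4*x0*y0^2*z0+y0^4-72*x0^2*y0) := by
    have := (LT 3 2 0 2 (8*m) (by ring)).add ((LT (-4) 1 2 1 (8*m) (by ring)).add
      ((LT 1 0 4 0 (8*m) (by ring)).add (LT (-72) 2 1 0 (8*m) (by ring))))
    convert this using 1
    · simp only [TT]; push_cast; ring
    · push_cast; ring
  have hF0 : FF x0 y0 z0 = 0 := by
    rw [← LF.2]
    exact coeff_eq_zero_of_natDegree_lt (by omega)
  have hm3 : 3 ≤ m := by
    by_contra hcon
    have hm' : m = 2 := by omega
    have hy : y0 = 0 := by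
      rw [hy0]; exact coeff_eq_zero_of_natDegree_lt (by omega)
    have hz : z0 = 0 := by
      rw [hz0]; exact coeff_eq_zero_of_natDegree_lt (by omega)
    rw [hy, hz] at hF0
    have : x0 = 0 := by
      have : 432 * x0^3 = 0 := by rw [FF] at hF0; linear_combination -hF0
      simpa using this
    exact hne ⟨this, hy, hz⟩
  have gen : ∀ (G J' : A[X]) (M N : ℕ) (g : A), LC G M g → J' = G * jac3 d1 d2 d3 x y z →
      J'.natDegree ≤ N → N < M + 6 → g = 0 := by
    intro G J' M N g hG hJ' hN hNM
    by_contra hg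
    have hd : G.natDegree = M := by
      refine le_antisymm hG.1 (le_natDegree_of_ne_zero ?_)
      rw [hG.2]; exact hg
    have hG0 : G ≠ 0 := by
      rintro rfl; exact hg (by rw [← hG.2]; simp)
    rw [hJ', natDegree_mul hG0 hJ0] at hN
    omega
  have s1 := gen _ _ _ _ _ LFx (jac3_Fx d1 d2 d3 x y z) (jac3_deg d1 d2 d3 h1 h2 h3 _ _ _)
    (by omega)
  have s2 := gen _ _ _ _ _ LFy (jac3_Fy d1 d2 d3 x y z) (jac3_deg d1 d2 d3 h1 h2 h3 _ _ _)
    (by omega)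
  have s3 := gen _ _ _ _ _ LFz (jac3_Fz d1 d2 d3 x y z) (jac3_deg d1 d2 d3 h1 h2 h3 _ _ _)
    (by omega)
  have s2' : (-x0*y0*z0^2+y0^3*z0-18*x0^2*z0+6*x0*y0^2) = 0 := by simpa using s2
  have hz0' : z0 ≠ 0 := by
    intro hz
    rw [hz] at s1 s2' s3
    have : y0 = 0 := by
      rcases eq_or_ne x0 0 with hx | hx
      · rw [hx] at s3
        have : y0^4 = 0 := by linear_combination s3
        simpa using this
      · have : 6 * x0 * y0^2 = 0 := by linear_combination s2'
        simpa [hx] using this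
    rw [this] at s1
    have hx : 1296 * x0^2 = 0 := by linear_combination -s1
    exact hne ⟨by simpa using hx, this, hz⟩
  have hzd : z.natDegree = m := le_antisymm hzm (le_natDegree_of_ne_zero (by rwa [← hz0]))
  have lt_of : ∀ (p : A[X]) (M : ℕ), 0 < M → LC p M 0 → p.natDegree < M := by
    intro p M hM hp
    refine lt_of_le_of_ne hp.1 ?_
    rintro h
    have h' := hp.2
    rw [← h, coeff_natDegree, leadingCoeff_eq_zero] at h'
    rw [h'] at h; simp at h; omega
  rcases sing_pts x0 y0 z0 s1 s2' s3 hz0' with ⟨e1, e2⟩ | ⟨e1, e2⟩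
  · refine core_A4 d1 d2 d3 h1 h2 h3 x y z hJ hb hc (by omega) ?_ ?_ hF
    · rw [hzd]; exact lt_of _ _ (by omega) (e1 ▸ Lx)
    · rw [hzd]; exact lt_of _ _ (by omega) (e2 ▸ Ly)
  · refine core_A2 d1 d2 d3 h1 h2 h3 x y z hJ (by omega) ?_ ?_ hF
    · rw [hzd]; refine lt_of _ _ (by omega) ?_
      rw [← e1]
      have := (LT 135 1 0 0 (3*m) (by ring)).add ((LT 18 0 1 1 (3*m) (by ring)).add
        (LT (-1) 0 0 3 (3*m) (by ring)))
      convert this using 1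
      · simp only [TT]; push_cast; ring
      · push_cast; ring
    · rw [hzd]; refine lt_of _ _ (by omega) ?_
      rw [← e2]
      have := (LT 3 0 1 0 (2*m) (by ring)).add (LT (-1) 0 0 2 (2*m) (by ring))
      convert this using 1
      · simp only [TT]; push_cast; ring
      · push_cast; ring

end core
section basics
open Polynomial

/-- abstract presentation of the ring `k[x,y,z,w]/(w²-F)` -/
structure QS (k Q : Type) [Field k] [CommRing Q] [Algebra k Q] where
  x : Q
  y : Q
  z : Q
  w : Q
  rel : w^2 = FF x y z
  lift : ∀ (B : Type) [CommRing B] [Algebra k B] (a b c d : B), d^2 = FF a b c →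
    ∃ f : Q →ₐ[k] B, f x = a ∧ f y = b ∧ f z = c ∧ f w = d
  gen : Algebra.adjoin k {x, y, z, w} = ⊤

theorem map_FF {B C : Type*} [CommRing B] [CommRing C] (f : B →+* C) (x y z : B) :
    f (FF x y z) = FF (f x) (f y) (f z) := by
  simp [FF, map_ofNat f]

/-- the presentation of the actual ring -/
def theQS (k : Type) [Field k] : QS k (QuinticInvariantRing k) where
  x := Ideal.Quotient.mk _ (MvPolynomial.X 0)
  y := Ideal.Quotient.mk _ (MvPolynomial.X 1)
  z := Ideal.Quotient.mk _ (MvPolynomial.X 2)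
  w := Ideal.Quotient.mk _ (MvPolynomial.X 3)
  rel := by
    rw [← map_FF, ← map_pow, Ideal.Quotient.eq]
    apply Ideal.subset_span
    have : rename Fin.castSucc (cayleyF k) = FF (MvPolynomial.X 0) (MvPolynomial.X 1) (MvPolynomial.X 2) := by
      have e (n : ℕ) [n.AtLeastTwo] : MvPolynomial.C (σ := Fin 4) (OfNat.ofNat n : k) = OfNat.ofNat n :=
        map_ofNat MvPolynomial.C n
      simp [cayleyF, FF, e]
    rw [this]; rfl
  lift := by
    intro B _ _ a b c d h
    refine ⟨Ideal.Quotient.liftₐ _ (MvPolynomial.aeval ![a,b,c,d]) ?_, ?_⟩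
    · intro p hp
      have : Ideal.span {(MvPolynomial.X 3 : MvPolynomial (Fin 4) k) ^ 2 - rename Fin.castSucc (cayleyF k)}
        ≤ RingHom.ker (MvPolynomial.aeval (R := k) ![a,b,c,d]) := by
        rw [Ideal.span_le, Set.singleton_subset_iff]
        have e (n : ℕ) [n.AtLeastTwo] : algebraMap k B (OfNat.ofNat n : k) = OfNat.ofNat n :=
          map_ofNat (algebraMap k B) n
        simp [RingHom.mem_ker, cayleyF, h, FF, e]
      exact this hp
    · refine ⟨?_, ?_, ?_, ?_⟩ <;>
      · refine (Ideal.Quotient.lift_mk _ _ _).trans ?_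
        simp
  gen := by
    have h1 : Algebra.adjoin k (Set.range (MvPolynomial.X : Fin 4 → MvPolynomial (Fin 4) k)) = ⊤ :=
      MvPolynomial.adjoin_range_X
    have h2 := congrArg (Subalgebra.map (Ideal.Quotient.mkₐ k (Ideal.span {(MvPolynomial.X 3 : MvPolynomial (Fin 4) k) ^ 2 - rename Fin.castSucc (cayleyF k)}))) h1
    rw [AlgHom.map_adjoin, Algebra.map_top, (AlgHom.range_eq_top _).2 (Ideal.Quotient.mkₐ_surjective _ _)] at h2
    rw [← h2]
    congr 1
    ext q
    simp only [Set.mem_insert_iff, Set.mem_singleton_iff, Set.mem_image, Set.mem_range]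
    constructor
    · rintro (h | h | h | h)
      · exact ⟨_, ⟨0, rfl⟩, h.symm⟩
      · exact ⟨_, ⟨1, rfl⟩, h.symm⟩
      · exact ⟨_, ⟨2, rfl⟩, h.symm⟩
      · exact ⟨_, ⟨3, rfl⟩, h.symm⟩
    · rintro ⟨_, ⟨i, rfl⟩, rfl⟩
      fin_cases i <;> simp

variable {k Q : Type} [Field k] [CommRing Q] [Algebra k Q] (S : QS k Q)

theorem QS.hom_ext {B : Type*} [CommRing B] [Algebra k B] {f g : Q →ₐ[k] B} (hx : f S.x = g S.x)
    (hy : f S.y = g S.y) (hz : f S.z = g S.z) (hw : f S.w = g S.w) : f = g := by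
  apply AlgHom.ext_of_adjoin_eq_top S.gen
  rintro _ (rfl | rfl | rfl | rfl) <;> assumption

theorem QS.der_ext {f g : Derivation k Q Q} (hx : f S.x = g S.x)
    (hy : f S.y = g S.y) (hz : f S.z = g S.z) (hw : f S.w = g S.w) : f = g := by
  apply Derivation.ext_of_adjoin_eq_top _ S.gen
  rintro _ (rfl | rfl | rfl | rfl) <;> assumption

theorem QS.ex_point [IsAlgClosed k] (a b c : k) :
    ∃ (f : Q →ₐ[k] k) (d : k), d ^ 2 = FF a b c ∧ f S.x = a ∧ f S.y = b ∧ f S.z = c ∧ f S.w = d := by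
  obtain ⟨d, hd⟩ := IsAlgClosed.exists_pow_nat_eq (FF a b c) (n := 2) (by norm_num)
  obtain ⟨f, hf⟩ := S.lift k a b c d hd
  exact ⟨f, d, hd, hf⟩

include S in
theorem QS.isDomain [CharZero k] : IsDomain Q := by
  let R := MvPolynomial (Fin 3) k
  let F : R := FF (MvPolynomial.X 0) (MvPolynomial.X 1) (MvPolynomial.X 2)
  let P : R[X] := Polynomial.X ^ 2 - Polynomial.C F
  have hns : ∀ r : R, r^2 ≠ F := by
    intro r hr
    let e : R →ₐ[k] k[X] := MvPolynomial.aeval ![Polynomial.X, 0, 0]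
    have h1 := congrArg e hr
    have h2 : e F = - Polynomial.C 432 * Polynomial.X ^ 3 := by
      have := map_FF (e : R →+* k[X]) (MvPolynomial.X 0) (MvPolynomial.X 1) (MvPolynomial.X 2)
      refine this.trans ?_
      have e0 : (e : R →+* k[X]) (MvPolynomial.X 0) = Polynomial.X := by
        exact (MvPolynomial.aeval_X _ _)
      have e1 : (e : R →+* k[X]) (MvPolynomial.X 1) = 0 := by
        exact (MvPolynomial.aeval_X _ _)
      have e2 : (e : R →+* k[X]) (MvPolynomial.X 2) = 0 := by
        exact (MvPolynomial.aeval_X _ _)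
      have e3 : Polynomial.C (432 : k) = 432 := rfl
      rw [e0, e1, e2, e3, FF]
      ring
    rw [h2, map_pow] at h1
    have h3 := congrArg natDegree h1
    rw [natDegree_pow, ← Polynomial.C_neg, natDegree_C_mul_X_pow _ _ (by norm_num)] at h3
    omega
  have hP : P.Monic := monic_X_pow_sub_C F (by norm_num)
  have hdeg : P.natDegree = 2 := natDegree_X_pow_sub_C
  have hirr : Irreducible P := by
    rw [hP.irreducible_iff_roots_eq_zero_of_degree_le_three (by omega) (by omega)]
    rw [Multiset.eq_zero_iff_forall_notMem]
    intro r hr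
    have := (mem_roots'.1 hr).2
    simp only [P, IsRoot.def, Polynomial.eval_sub, Polynomial.eval_pow, Polynomial.eval_X, Polynomial.eval_C] at this
    exact hns r (sub_eq_zero.1 this)
  have : IsDomain (AdjoinRoot P) := AdjoinRoot.isDomain_of_prime hirr.prime
  let o := AdjoinRoot.of P
  obtain ⟨f, fx, fy, fz, fw⟩ := S.lift (AdjoinRoot P) (o (MvPolynomial.X 0)) (o (MvPolynomial.X 1))
    (o (MvPolynomial.X 2)) (AdjoinRoot.root P) (by
      rw [← map_FF]
      have := AdjoinRoot.eval₂_root P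
      simp only [P, Polynomial.eval₂_sub, Polynomial.eval₂_pow, Polynomial.eval₂_X, Polynomial.eval₂_C] at this
      exact sub_eq_zero.1 this)
  let i : R →ₐ[k] Q := MvPolynomial.aeval ![S.x, S.y, S.z]
  have i0 : i (MvPolynomial.X 0) = S.x := MvPolynomial.aeval_X _ _
  have i1 : i (MvPolynomial.X 1) = S.y := MvPolynomial.aeval_X _ _
  have i2 : i (MvPolynomial.X 2) = S.z := MvPolynomial.aeval_X _ _
  have hi : i F = S.w^2 := by
    rw [S.rel]
    refine (map_FF (i : R →+* Q) _ _ _).trans ?_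
    rw [← i0, ← i1, ← i2]
    rfl
  have hev : Polynomial.eval₂ (i : R →+* Q) S.w P = 0 := by
    simp only [P, Polynomial.eval₂_sub, Polynomial.eval₂_pow, Polynomial.eval₂_X, Polynomial.eval₂_C]
    exact sub_eq_zero.2 hi.symm
  let g : AdjoinRoot P →+* Q := AdjoinRoot.lift (i : R →+* Q) S.w hev
  have hgo : ∀ r, g (o r) = i r := fun r => AdjoinRoot.lift_of _
  let g' : AdjoinRoot P →ₐ[k] Q := { g with
    commutes' := fun r => by
      have : algebraMap k (AdjoinRoot P) r = o (algebraMap k R r) := rfl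
      rw [this]
      refine (hgo _).trans ?_
      exact i.commutes r }
  have hgf : g'.comp f = AlgHom.id k Q := by
    apply S.hom_ext
    · rw [AlgHom.comp_apply, fx]; exact (hgo _).trans i0
    · rw [AlgHom.comp_apply, fy]; exact (hgo _).trans i1
    · rw [AlgHom.comp_apply, fz]; exact (hgo _).trans i2
    · rw [AlgHom.comp_apply, fw]; exact AdjoinRoot.lift_root hev
  have hinj : Function.Injective f := by
    apply Function.LeftInverse.injective (g := g')
    intro q
    exact DFunLike.congr_fun hgf q
  exact hinj.isDomain (f : Q →+* AdjoinRoot P)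

end basics
section grading
open Polynomial DirectSum
variable {k Q : Type} [Field k] [CommRing Q] [Algebra k Q] (S : QS k Q)

/-- monomials -/
def QS.mono (a b c e : ℕ) : Q := S.x^a * S.y^b * S.z^c * S.w^e

/-- graded pieces -/
def QS.gr (n : ℤ) : Submodule k Q :=
  Submodule.span k {m | ∃ a b c e : ℕ, (6*a+4*b+2*c+9*e : ℤ) = n ∧ S.mono a b c e = m}

theorem QS.mono_mem {a b c e : ℕ} {n : ℤ} (h : (6*a+4*b+2*c+9*e : ℤ) = n) :
    S.mono a b c e ∈ S.gr n := Submodule.subset_span ⟨a, b, c, e, h, rfl⟩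

theorem QS.x_mem : S.x ∈ S.gr 6 := by
  simpa [QS.mono] using S.mono_mem (a := 1) (b := 0) (c := 0) (e := 0) (n := 6) (by norm_num)
theorem QS.y_mem : S.y ∈ S.gr 4 := by
  simpa [QS.mono] using S.mono_mem (a := 0) (b := 1) (c := 0) (e := 0) (n := 4) (by norm_num)
theorem QS.z_mem : S.z ∈ S.gr 2 := by
  simpa [QS.mono] using S.mono_mem (a := 0) (b := 0) (c := 1) (e := 0) (n := 2) (by norm_num)
theorem QS.w_mem : S.w ∈ S.gr 9 := by
  simpa [QS.mono] using S.mono_mem (a := 0) (b := 0) (c := 0) (e := 1) (n := 9) (by norm_num)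

instance QS.gradedMonoid : SetLike.GradedMonoid S.gr where
  one_mem := by
    simpa [QS.mono] using S.mono_mem (a := 0) (b := 0) (c := 0) (e := 0) (n := 0) (by norm_num)
  mul_mem := by
    intro m n p q hp hq
    have h := Submodule.mul_mem_mul hp hq
    rw [QS.gr, QS.gr, Submodule.span_mul_span] at h
    refine Submodule.span_le.2 ?_ h
    rintro _ ⟨_, ⟨a, b, c, e, h1, rfl⟩, _, ⟨a', b', c', e', h2, rfl⟩, rfl⟩
    have := S.mono_mem (a := a+a') (b := b+b') (c := c+c') (e := e+e') (n := m+n)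
      (by push_cast; linarith)
    have e1 : S.mono a b c e * S.mono a' b' c' e' = S.mono (a+a') (b+b') (c+c') (e+e') := by
      simp only [QS.mono]; ring
    rw [← e1] at this; exact this

/-- the element of the direct sum -/
def QS.inc (n : ℤ) (q : Q) (h : q ∈ S.gr n) : ⨁ i, S.gr i := DirectSum.of (fun i => S.gr i) n ⟨q, h⟩

theorem QS.inc_mul {m n : ℤ} {p q : Q} (hp : p ∈ S.gr m) (hq : q ∈ S.gr n) :
    S.inc m p hp * S.inc n q hq = S.inc (m+n) (p*q) (SetLike.mul_mem_graded hp hq) :=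
  DirectSum.of_mul_of _ _

theorem QS.inc_pow {m : ℤ} {p : Q} (hp : p ∈ S.gr m) (n : ℕ) :
    S.inc m p hp ^ n = S.inc (n • m) (p^n) (SetLike.pow_mem_graded n hp) :=
  DirectSum.ofPow _ _ _

theorem QS.inc_congr {m n : ℤ} {p q : Q} (hp : p ∈ S.gr m) (hq : q ∈ S.gr n) (h : m = n)
    (h' : p = q) : S.inc m p hp = S.inc n q hq := by
  subst h; subst h'; rfl

theorem QS.ex_dec : ∃ f : Q →ₐ[k] ⨁ i, S.gr i, f S.x = S.inc 6 S.x S.x_mem ∧ 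
    f S.y = S.inc 4 S.y S.y_mem ∧ f S.z = S.inc 2 S.z S.z_mem ∧ f S.w = S.inc 9 S.w S.w_mem := by
  refine S.lift (⨁ i, S.gr i) _ _ _ _ ?_
  have hmem : FF S.x S.y S.z ∈ S.gr 18 := by
    rw [← S.rel]
    exact SetLike.pow_mem_graded 2 S.w_mem
  have e (n : ℕ) : ((n : ℕ) : ⨁ i, S.gr i) = S.inc 0 (n : Q) (SetLike.natCast_mem_graded S.gr n) := rfl
  have e2 (n : ℕ) [n.AtLeastTwo] : (OfNat.ofNat n : ⨁ i, S.gr i)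
    = S.inc 0 (OfNat.ofNat n : Q) (SetLike.natCast_mem_graded S.gr n) := e n
  have eadd {m n : ℤ} {p q : Q} (hp : p ∈ S.gr m) (hq : q ∈ S.gr n) (h : m = n) :
      S.inc m p hp + S.inc n q hq = S.inc m (p+q) (by subst h; exact add_mem hp hq) := by
    subst h
    exact (map_add (DirectSum.of (fun i => S.gr i) m) _ _).symm
  have esub {m n : ℤ} {p q : Q} (hp : p ∈ S.gr m) (hq : q ∈ S.gr n) (h : m = n) :
      S.inc m p hp - S.inc n q hq = S.inc m (p-q) (by subst h; exact sub_mem hp hq) := by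
    subst h
    exact (map_sub (DirectSum.of (fun i => S.gr i) m) _ _).symm
  rw [S.inc_pow]
  simp only [FF, e2, S.inc_pow, S.inc_mul]
  rw [esub _ _ (by norm_num), eadd _ _ (by norm_num), esub _ _ (by norm_num), eadd _ _ (by norm_num), esub _ _ (by norm_num)]
  · apply S.inc_congr 
    · norm_num
    · exact S.rel

/-- decomposition map -/
def QS.dec : Q →ₐ[k] ⨁ i, S.gr i := S.ex_dec.choose

theorem QS.dec_mono (a b c e : ℕ) (n : ℤ) (h : (6*a+4*b+2*c+9*e : ℤ) = n) :
    S.dec (S.mono a b c e) = S.inc n _ (S.mono_mem h) := by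
  obtain ⟨h1, h2, h3, h4⟩ := S.ex_dec.choose_spec
  change S.dec _ = _ at h1 
  change S.dec _ = _ at h2
  change S.dec _ = _ at h3
  change S.dec _ = _ at h4
  simp only [QS.mono, map_mul, map_pow, h1, h2, h3, h4, S.inc_pow, S.inc_mul]
  apply S.inc_congr _ _ _ rfl
  rw [← h]; simp; ring

instance QS.graded : GradedAlgebra S.gr := by
  refine GradedAlgebra.ofAlgHom S.gr S.dec ?_ ?_
  · obtain ⟨h1, h2, h3, h4⟩ := S.ex_dec.choose_spec
    change S.dec _ = _ at h1 
    change S.dec _ = _ at h2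
    change S.dec _ = _ at h3
    change S.dec _ = _ at h4
    apply S.hom_ext 
    · simp [h1, QS.inc]
    · simp [h2, QS.inc]
    · simp [h3, QS.inc]
    · simp [h4, QS.inc]
  · rintro n ⟨q, hq⟩
    change S.dec q = S.inc n q hq
    have : ∀ q (hq : q ∈ S.gr n), S.dec q = S.inc n q hq := by
      intro q hq
      induction hq using Submodule.span_induction with
      | mem m hm =>
        obtain ⟨a, b, c, e, h, rfl⟩ := hm
        exact S.dec_mono a b c e n h
      | zero => rw [map_zero]; exact (map_zero (DirectSum.of (fun i => S.gr i) n)).symm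
      | add p q hp hq h1 h2 => 
        rw [map_add, h1, h2]; exact (map_add (DirectSum.of (fun i => S.gr i) n) _ _).symm
      | smul c p hp h =>
        rw [map_smul, h]; exact (map_smul (DirectSum.lof k _ (fun i => S.gr i) n) c _).symm
    exact this q hq

theorem QS.gr_le {n : ℤ} {P : Submodule k Q}
    (h : ∀ a b c e : ℕ, (6*a+4*b+2*c+9*e : ℤ) = n → S.mono a b c e ∈ P) : S.gr n ≤ P := by
  refine Submodule.span_le.2 ?_
  rintro _ ⟨a, b, c, e, h1, rfl⟩
  exact h a b c e h1

theorem QS.gr_neg {n : ℤ} (hn : n < 0) {q : Q} (hq : q ∈ S.gr n) : q = 0 := by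
  have : S.gr n ≤ ⊥ := S.gr_le fun a b c e h => by omega
  simpa using this hq

theorem QS.gr_odd {n : ℤ} (hn : Odd n) {q : Q} (hq : q ∈ S.gr n) : S.w ∣ q := by
  have : S.gr n ≤ (Ideal.span {S.w}).restrictScalars k := S.gr_le fun a b c e h => by
    obtain ⟨e, rfl⟩ : ∃ e', e = e' + 1 := ⟨e - 1, by have := hn; rw [Int.odd_iff] at this; omega⟩
    refine Ideal.mem_span_singleton.2 ?_
    simp only [QS.mono, pow_succ]
    exact ⟨S.x^a * S.y^b * S.z^c * S.w^e, by ring⟩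
  exact Ideal.mem_span_singleton.1 (this hq)

theorem QS.gr_zero {q : Q} (hq : q ∈ S.gr 0) : ∃ c : k, q = c • 1 := by
  have : S.gr 0 ≤ Submodule.span k {1} := S.gr_le fun a b c e h => by
    obtain rfl : a = 0 := by omega
    obtain rfl : b = 0 := by omega
    obtain rfl : c = 0 := by omega
    obtain rfl : e = 0 := by omega
    simp [QS.mono]
  obtain ⟨c, hc⟩ := Submodule.mem_span_singleton.1 (this hq)
  exact ⟨c, hc.symm⟩

theorem QS.gr_one {q : Q} (hq : q ∈ S.gr 1) : q = 0 := by
  have : S.gr 1 ≤ ⊥ := S.gr_le fun a b c e h => by omega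
  simpa using this hq

theorem QS.gr_two {q : Q} (hq : q ∈ S.gr 2) : ∃ c : k, q = c • S.z := by
  have : S.gr 2 ≤ Submodule.span k {S.z} := S.gr_le fun a b c e h => by
    obtain rfl : a = 0 := by omega
    obtain rfl : b = 0 := by omega
    obtain rfl : c = 1 := by omega
    obtain rfl : e = 0 := by omega
    simp [QS.mono]
  obtain ⟨c, hc⟩ := Submodule.mem_span_singleton.1 (this hq)
  exact ⟨c, hc.symm⟩

theorem QS.gr_nine {q : Q} (hq : q ∈ S.gr 9) : ∃ c : k, q = c • S.w := by
  have : S.gr 9 ≤ Submodule.span k {S.w} := S.gr_le fun a b c e h => by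
    obtain rfl : a = 0 := by omega
    obtain rfl : b = 0 := by omega
    obtain rfl : c = 0 := by omega
    obtain rfl : e = 1 := by omega
    simp [QS.mono]
  obtain ⟨c, hc⟩ := Submodule.mem_span_singleton.1 (this hq)
  exact ⟨c, hc.symm⟩

theorem QS.gr_four {q : Q} (hq : q ∈ S.gr 4) : ∃ c d : k, q = c • S.y + d • S.z^2 := by
  have : S.gr 4 ≤ Submodule.span k {S.y, S.z^2} := S.gr_le fun a b c e h => by
    obtain rfl : a = 0 := by omega
    obtain rfl : e = 0 := by omega
    obtain rfl | rfl : b = 0 ∨ b = 1 := by omega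
    · obtain rfl : c = 2 := by omega
      apply Submodule.subset_span; simp [QS.mono]
    · obtain rfl : c = 0 := by omega
      apply Submodule.subset_span; simp [QS.mono]
  obtain ⟨c, d, hc⟩ := Submodule.mem_span_pair.1 (this hq)
  exact ⟨c, d, hc.symm⟩

theorem QS.gr_six {q : Q} (hq : q ∈ S.gr 6) :
    ∃ c d f : k, q = c • S.x + d • (S.y * S.z) + f • S.z^3 := by
  have : S.gr 6 ≤ Submodule.span k {S.x, S.y * S.z, S.z^3} := S.gr_le fun a b c e h => by
    obtain rfl : e = 0 := by omega
    obtain rfl | rfl : a = 0 ∨ a = 1 := by omega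
    · obtain rfl | rfl : b = 0 ∨ b = 1 := by omega
      · obtain rfl : c = 3 := by omega
        apply Submodule.subset_span; simp [QS.mono]
      · obtain rfl : c = 1 := by omega
        apply Submodule.subset_span; simp [QS.mono]
    · obtain rfl : b = 0 := by omega
      obtain rfl : c = 0 := by omega
      apply Submodule.subset_span; simp [QS.mono]
  obtain ⟨c, d, f, hc⟩ := Submodule.mem_span_triple.1 (this hq)
  exact ⟨c, d, f, hc.symm⟩

end grading
section lnd
open Polynomial
variable {k Q : Type} [Field k] [CommRing Q] [Algebra k Q]

theorem QS.ex_der (S : QS k Q) (p q r s : Q)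
    (h : 2*S.w*s = (2*S.x*S.z^3-2*S.y^2*S.z^2-144*S.x*S.y*S.z+8*S.y^3-1296*S.x^2)*p
      + (-4*S.x*S.y*S.z^2+4*S.y^3*S.z-72*S.x^2*S.z+24*S.x*S.y^2)*q
      + (3*S.x^2*S.z^2-4*S.x*S.y^2*S.z+S.y^4-72*S.x^2*S.y)*r) :
    ∃ D : Derivation k Q Q, D S.x = p ∧ D S.y = q ∧ D S.z = r ∧ D S.w = s := by
  let T := TrivSqZeroExt Q Q
  obtain ⟨f, h1, h2, h3, h4⟩ := S.lift T ((S.x, p) : Q × Q) ((S.y, q) : Q × Q)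
    ((S.z, r) : Q × Q) ((S.w, s) : Q × Q) (by
      have e2 (n : ℕ) [n.AtLeastTwo] : TrivSqZeroExt.snd (OfNat.ofNat n : TrivSqZeroExt Q Q) = 0 :=
        TrivSqZeroExt.snd_natCast n
      have e1 (n : ℕ) [n.AtLeastTwo] : TrivSqZeroExt.fst (OfNat.ofNat n : TrivSqZeroExt Q Q) = OfNat.ofNat n :=
        TrivSqZeroExt.fst_natCast n
      have f1 (a b : Q) : TrivSqZeroExt.fst (R := Q) (M := Q) ((a, b) : Q × Q) = a := rfl
      have f2 (a b : Q) : TrivSqZeroExt.snd (R := Q) (M := Q) ((a, b) : Q × Q) = b := rfl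
      have key : ∀ X Y Z W : TrivSqZeroExt Q Q, X.fst = S.x → X.snd = p → Y.fst = S.y → Y.snd = q →
          Z.fst = S.z → Z.snd = r → W.fst = S.w → W.snd = s → W^2 = FF X Y Z := by
        intro X Y Z W a1 a2 a3 a4 a5 a6 a7 a8
        apply TrivSqZeroExt.ext
        · simp only [FF, TrivSqZeroExt.fst_sub, TrivSqZeroExt.fst_add, TrivSqZeroExt.fst_mul,
            TrivSqZeroExt.fst_pow, e1, a1, a3, a5, a7]
          exact S.rel
        · simp only [FF, pow_succ, pow_zero, one_mul, TrivSqZeroExt.fst_sub, TrivSqZeroExt.fst_add, TrivSqZeroExt.fst_mul,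
            TrivSqZeroExt.snd_sub, TrivSqZeroExt.snd_add, TrivSqZeroExt.snd_mul,
            e1, e2, a1, a2, a3, a4, a5, a6, a7, a8, smul_eq_mul, MulOpposite.smul_eq_mul_unop,
            MulOpposite.unop_op, mul_zero, zero_mul, zero_add, add_zero]
          linear_combination h
      exact key _ _ _ _ rfl rfl rfl rfl rfl rfl rfl rfl)
  have hfst : (TrivSqZeroExt.fstHom k Q Q).comp f = AlgHom.id k Q := by
    apply S.hom_ext
    · rw [AlgHom.comp_apply, h1]; rfl
    · rw [AlgHom.comp_apply, h2]; rfl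
    · rw [AlgHom.comp_apply, h3]; rfl
    · rw [AlgHom.comp_apply, h4]; rfl
  have hfst' (a : Q) : TrivSqZeroExt.fst (f a) = a := DFunLike.congr_fun hfst a
  let L : Q →ₗ[k] Q := 
    { toFun := fun a => TrivSqZeroExt.snd (f a)
      map_add' := fun a b => by rw [map_add]; rfl
      map_smul' := fun c a => by rw [map_smul]; rfl }
  refine ⟨Derivation.mk' L ?_, ?_, ?_, ?_, ?_⟩
  · intro a b
    change TrivSqZeroExt.snd (f (a * b)) = a • TrivSqZeroExt.snd (f b) + b • TrivSqZeroExt.snd (f a)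
    rw [map_mul, TrivSqZeroExt.snd_mul, hfst', hfst']
    simp [mul_comm]
  · change TrivSqZeroExt.snd (f _) = _; rw [h1]; rfl
  · change TrivSqZeroExt.snd (f _) = _; rw [h2]; rfl
  · change TrivSqZeroExt.snd (f _) = _; rw [h3]; rfl
  · change TrivSqZeroExt.snd (f _) = _; rw [h4]; rfl

/-- coefficientwise linear map -/
def mcL (d : Derivation k Q Q) : Q[X] →ₗ[k] Q[X] :=
  Polynomial.lsum (fun n => ((Polynomial.monomial n).restrictScalars k).comp (d : Q →ₗ[k] Q))

theorem coeff_mcL (d : Derivation k Q Q) (p : Q[X]) (n : ℕ) : (mcL d p).coeff n = d (p.coeff n) := by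
  induction p using Polynomial.induction_on' with
  | add p q hp hq => rw [map_add, Polynomial.coeff_add, hp, hq, Polynomial.coeff_add, map_add]
  | monomial m a =>
    have : mcL d (Polynomial.monomial m a) = Polynomial.monomial m (d a) := by
      simp only [mcL, Polynomial.lsum_apply]
      rw [Polynomial.sum_monomial_index] 
      · simp
      · simp
    rw [this, Polynomial.coeff_monomial, Polynomial.coeff_monomial]
    split_ifs <;> simp

/-- coefficientwise derivation -/
def mc (d : Derivation k Q Q) : Derivation k Q[X] Q[X] := Derivation.mk' (mcL d) (by
  intro p q
  ext n
  simp only [smul_eq_mul, Polynomial.coeff_add, coeff_mcL, Polynomial.coeff_mul]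
  rw [map_sum, ← Finset.Nat.sum_antidiagonal_swap (f := fun x => q.coeff x.1 * _), ← Finset.sum_add_distrib]
  apply Finset.sum_congr rfl
  intro x hx
  simp)

theorem coeff_mc (d : Derivation k Q Q) (p : Q[X]) (n : ℕ) : (mc d p).coeff n = d (p.coeff n) :=
  coeff_mcL d p n

theorem mc_deg (d : Derivation k Q Q) (p : Q[X]) : (mc d p).natDegree ≤ p.natDegree := by
  rw [natDegree_le_iff_coeff_eq_zero]
  intro n hn
  rw [coeff_mc, coeff_eq_zero_of_natDegree_lt hn, map_zero]

/-- `t d/dt` -/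
def theta : Derivation k Q[X] Q[X] :=
  (Polynomial.X : Q[X]) • (Polynomial.derivative' : Derivation Q Q[X] Q[X]).restrictScalars k

theorem theta_apply (p : Q[X]) : theta (k := k) p = Polynomial.X * derivative p := rfl

theorem theta_deg (p : Q[X]) : (theta (k := k) p).natDegree ≤ p.natDegree := by
  rw [theta_apply]
  by_cases h : p.natDegree = 0
  · rw [Polynomial.eq_C_of_natDegree_eq_zero h]; simp
  · refine (natDegree_mul_le.trans ?_)
    have := natDegree_derivative_lt h
    have := Polynomial.natDegree_X_le (R := Q)
    omega

variable (D : Derivation k Q Q) (hD : ∀ h, ∃ n : ℕ, D^[n] h = 0)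

theorem iter_zero (n : ℕ) : D^[n] 0 = 0 := by
  induction n with
  | zero => rfl
  | succ n ih => rw [Function.iterate_succ_apply', ih, map_zero]

theorem iter_stay {n m : ℕ} {h : Q} (hn : D^[n] h = 0) (hm : n ≤ m) : D^[m] h = 0 := by
  obtain ⟨j, rfl⟩ := Nat.exists_eq_add_of_le' hm
  rw [Function.iterate_add_apply, hn, iter_zero]

/-- exponential -/
def ex (h : Q) : Q[X] := 
  ∑ n ∈ Finset.range (hD h).choose, Polynomial.monomial n (((n.factorial : k)⁻¹) • D^[n] h)

theorem coeff_ex (h : Q) (n : ℕ) : (ex D hD h).coeff n = ((n.factorial : k)⁻¹) • D^[n] h := by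
  simp only [ex, Polynomial.finsetSum_coeff, Polynomial.coeff_monomial]
  rw [Finset.sum_ite_eq']
  split_ifs with hn
  · rfl
  · rw [iter_stay D (hD h).choose_spec (by simpa using hn), smul_zero]

variable [CharZero k]

theorem ex_derivative (h : Q) : derivative (ex D hD h) = mc D (ex D hD h) := by
  ext n
  rw [Polynomial.coeff_derivative, coeff_mc, coeff_ex, coeff_ex, Derivation.map_smul,
    ← Function.iterate_succ_apply' D, mul_comm, ← Nat.cast_succ, ← nsmul_eq_mul,
    ← Nat.cast_smul_eq_nsmul k, smul_smul]
  congr 1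
  rw [Nat.factorial_succ]
  have := Nat.factorial_ne_zero n
  push_cast
  field_simp

theorem ex_D (h : Q) : ex D hD (D h) = mc D (ex D hD h) := by
  ext n
  rw [coeff_mc, coeff_ex, coeff_ex, Derivation.map_smul,
    ← Function.iterate_succ_apply' D, ← Function.iterate_succ_apply D]

theorem ex_unique (p : Q[X]) (h : derivative p = mc D p) (h0 : p.coeff 0 = 0) : p = 0 := by
  ext n
  induction n with
  | zero => simpa using h0
  | succ n ih =>
    have := congrArg (fun p => p.coeff n) h
    simp only [Polynomial.coeff_derivative, coeff_mc, ih, Polynomial.coeff_zero, map_zero] at this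
    have h2 : ((n + 1 : k)) • p.coeff (n+1) = 0 := by
      rw [Algebra.smul_def]; simpa [mul_comm] using this
    rcases smul_eq_zero.1 h2 with h3 | h3
    · exact absurd h3 (by exact_mod_cast Nat.succ_ne_zero n)
    · simpa using h3

theorem ex_mul (a b : Q) : ex D hD (a*b) = ex D hD a * ex D hD b := by
  rw [← sub_eq_zero]
  apply ex_unique D
  · rw [map_sub, map_sub, derivative_mul, Derivation.leibniz, ex_derivative, ex_derivative, ex_derivative]
    simp only [smul_eq_mul]; ring
  · simp [coeff_ex, Polynomial.mul_coeff_zero]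

/-- exponential ring hom -/
def exH : Q →+* Q[X] where
  toFun := ex D hD
  map_one' := by
    ext n
    rw [coeff_ex, Polynomial.coeff_one]
    rcases n with _ | n
    · simp
    · rw [Function.iterate_succ_apply]; simp [iter_zero]
  map_mul' := ex_mul D hD
  map_zero' := by ext n; simp [coeff_ex, iter_zero]
  map_add' a b := by
    ext n
    have : D^[n] (a+b) = D^[n] a + D^[n] b := by
      induction n with
      | zero => rfl
      | succ n ih => simp only [Function.iterate_succ_apply', ih, map_add]
    simp [coeff_ex, this]

theorem exH_apply (h : Q) : exH D hD h = ex D hD h := rfl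

theorem ex_ne_zero {h : Q} (hh : h ≠ 0) : ex D hD h ≠ 0 := by
  intro e
  have := congrArg (fun p => p.coeff 0) e
  simp [coeff_ex, hh] at this

theorem ex_deg_le {h : Q} {n : ℕ} (hn : D^[n+1] h = 0) : (ex D hD h).natDegree ≤ n := by
  rw [natDegree_le_iff_coeff_eq_zero]
  intro m hm
  rw [coeff_ex, iter_stay D hn hm, smul_zero]

variable [IsDomain Q]
theorem ex_deg_mul {a b : Q} (h : a * b ≠ 0) :
    (ex D hD (a*b)).natDegree = (ex D hD a).natDegree + (ex D hD b).natDegree := by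
  rw [ex_mul, natDegree_mul (ex_ne_zero D hD (left_ne_zero_of_mul h)) 
    (ex_ne_zero D hD (right_ne_zero_of_mul h))]

include hD in
theorem ex_dvd {a : Q} (h : a ∣ D a) : D a = 0 := by
  obtain ⟨b, hb⟩ := h
  by_contra hne
  have h1 := ex_deg_mul D hD (hb ▸ hne)
  rw [← hb, ex_D, ← ex_derivative] at h1
  by_cases h0 : (ex D hD a).natDegree = 0
  · apply hne
    have := coeff_eq_zero_of_natDegree_lt (p := ex D hD a) (n := 1) (by omega)
    simpa [coeff_ex] using this
  · have := natDegree_derivative_lt h0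
    omega

end lnd
section rigid
open Polynomial
variable {k Q : Type} [Field k] [CommRing Q] [Algebra k Q] [CharZero k] [IsDomain Q] (S : QS k Q)

theorem QS.w_ne [IsAlgClosed k] : S.w ≠ 0 := by
  obtain ⟨f, d, h, -, -, -, h4⟩ := S.ex_point 0 1 1
  intro h0
  rw [h0, map_zero] at h4
  simp [← h4, FF] at h

theorem natDegree_exp6 (p : Q[X]) : (expand Q 6 p).natDegree = p.natDegree * 6 := natDegree_expand 6 p

theorem theta_expand (D : Derivation k Q Q) (hD : ∀ h, ∃ n : ℕ, D^[n] h = 0) (h : Q) :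
    theta (k := k) (expand Q 6 (ex D hD h)) = (6 * Polynomial.X^6) * mc D (expand Q 6 (ex D hD h)) := by
  rw [theta_apply, derivative_expand, ex_derivative]
  have : mc D (expand Q 6 (ex D hD h)) = expand Q 6 (mc D (ex D hD h)) := by
    ext n
    rw [coeff_mc, Polynomial.coeff_expand (by norm_num), Polynomial.coeff_expand (by norm_num)]
    split_ifs
    · rw [coeff_mc]
    · rw [map_zero]
  rw [this]
  push_cast
  ring

theorem jac_coeff0 (d1 d2 d3 : Derivation k Q Q) (f g h : Q[X]) :
    (jac3 (mc d1) (mc d2) (mc d3) f g h).coeff 0 =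
     d1 (f.coeff 0) * (d2 (g.coeff 0) * d3 (h.coeff 0) - d3 (g.coeff 0) * d2 (h.coeff 0))
     - d2 (f.coeff 0) * (d1 (g.coeff 0) * d3 (h.coeff 0) - d3 (g.coeff 0) * d1 (h.coeff 0))
    + d3 (f.coeff 0) * (d1 (g.coeff 0) * d2 (h.coeff 0) - d2 (g.coeff 0) * d1 (h.coeff 0)) := by
  simp [jac3, Polynomial.mul_coeff_zero, coeff_mc]

theorem deg6 [CharZero Q] {p : Q[X]} (h : p.coeff 0 ≠ 0) : 6 ≤ ((6 * Polynomial.X^6) * p).natDegree := by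
  have hp : p ≠ 0 := fun e => h (by simp [e])
  have h6 : (6 : Q[X]) ≠ 0 := by norm_num
  rw [natDegree_mul (mul_ne_zero h6 (pow_ne_zero _ Polynomial.X_ne_zero)) hp,
    natDegree_mul h6 (pow_ne_zero _ Polynomial.X_ne_zero), natDegree_X_pow]
  omega

theorem QS.rigid_of_deg [IsAlgClosed k] (D : Derivation k Q Q) (hD : ∀ h, ∃ n : ℕ, D^[n] h = 0)
    (hw : (ex D hD S.w).natDegree ≤ 1) : D = 0 := by
  have : CharZero Q := charZero_of_injective_algebraMap (algebraMap k Q).injective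
  by_contra hne
  have hw0 := S.w_ne
  have h2 : (2 : Q) ≠ 0 := by norm_num
  obtain ⟨a, ax, ay, az, aw⟩ := S.ex_der (2*S.w) 0 0
    (2*S.x*S.z^3-2*S.y^2*S.z^2-144*S.x*S.y*S.z+8*S.y^3-1296*S.x^2) (by ring)
  obtain ⟨b, bx, bY, bz, bw⟩ := S.ex_der 0 (2*S.w) 0
    (-4*S.x*S.y*S.z^2+4*S.y^3*S.z-72*S.x^2*S.z+24*S.x*S.y^2) (by ring)
  obtain ⟨c, cx, cy, cz, cw⟩ := S.ex_der 0 0 (2*S.w)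
    (3*S.x^2*S.z^2-4*S.x*S.y^2*S.z+S.y^4-72*S.x^2*S.y) (by ring)
  let x := expand Q 6 (ex D hD S.x)
  let y := expand Q 6 (ex D hD S.y)
  let z := expand Q 6 (ex D hD S.z)
  have c0 (h : Q) : (expand Q 6 (ex D hD h)).coeff 0 = h := by
    have := Polynomial.coeff_expand_mul (p := 6) (by norm_num) (ex D hD h) 0
    rw [zero_mul] at this
    rw [this, coeff_ex]; simp
  have hF : (FF x y z).natDegree ≤ 12 := by
    have h1 := map_FF ((expand Q 6 : Q[X] →+* Q[X]).comp (exH D hD)) S.x S.y S.z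
    have h3 : FF x y z = (expand Q 6 (ex D hD S.w))^2 := by
      refine h1.symm.trans ?_
      rw [← S.rel, map_pow]; rfl
    rw [h3, natDegree_pow, natDegree_exp6]
    omega
  have hxd : 6 ∣ x.natDegree := ⟨_, by rw [natDegree_exp6, mul_comm]⟩
  have hyd : 6 ∣ y.natDegree := ⟨_, by rw [natDegree_exp6, mul_comm]⟩
  have hzd : 6 ∣ z.natDegree := ⟨_, by rw [natDegree_exp6, mul_comm]⟩
  have key : ∀ d1 d2 d3 : Derivation k Q[X] Q[X], (∀ p, (d1 p).natDegree ≤ p.natDegree) →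
     (∀ p, (d2 p).natDegree ≤ p.natDegree) → (∀ p, (d3 p).natDegree ≤ p.natDegree) → 
     6 ≤ (jac3 d1 d2 d3 x y z).natDegree → False := fun d1 d2 d3 h1 h2 h3 hJ =>
    core_main d1 d2 d3 h1 h2 h3 x y z hJ hxd hyd hzd hF
  have hcase : D S.x ≠ 0 ∨ D S.y ≠ 0 ∨ D S.z ≠ 0 := by
    by_contra hcon
    push Not at hcon
    obtain ⟨e1, e2, e3⟩ := hcon
    apply hne
    apply S.der_ext
    · simpa using e1
    · simpa using e2
    · simpa using e3
    · have h4 : D (S.w^2) = 0 := by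
        rw [S.rel]
        have (n : ℕ) [n.AtLeastTwo] : D (OfNat.ofNat n) = 0 := Derivation.map_natCast D n
        simp [FF, e1, e2, e3, this]
      simpa [Derivation.leibniz_pow, hw0, h2] using h4
  have tx : theta (k := k) x = _ := theta_expand D hD S.x
  have ty : theta (k := k) y = _ := theta_expand D hD S.y
  have tz : theta (k := k) z = _ := theta_expand D hD S.z
  have cx0 : x.coeff 0 = S.x := c0 _
  have cy0 : y.coeff 0 = S.y := c0 _
  have cz0 : z.coeff 0 = S.z := c0 _
  rcases hcase with h | h | h
  · refine key theta (mc b) (mc c) theta_deg (mc_deg _) (mc_deg _) ?_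
    have : jac3 theta (mc b) (mc c) x y z
      = (6 * Polynomial.X^6) * jac3 (mc D) (mc b) (mc c) x y z := by
      simp only [jac3, tx, ty, tz]; ring
    rw [this]
    apply deg6
    rw [jac_coeff0, cx0, cy0, cz0]
    simp [bx, bY, bz, cx, cy, cz, h, hw0, h2]
  · refine key (mc a) theta (mc c) (mc_deg _) theta_deg (mc_deg _) ?_
    have : jac3 (mc a) theta (mc c) x y z
      = (6 * Polynomial.X^6) * jac3 (mc a) (mc D) (mc c) x y z := by
      simp only [jac3, tx, ty, tz]; ring
    rw [this]
    apply deg6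
    rw [jac_coeff0, cx0, cy0, cz0]
    simp [ax, ay, az, cx, cy, cz, h, hw0, h2]
  · refine key (mc a) (mc b) theta (mc_deg _) (mc_deg _) theta_deg ?_
    have : jac3 (mc a) (mc b) theta x y z
      = (6 * Polynomial.X^6) * jac3 (mc a) (mc b) (mc D) x y z := by
      simp only [jac3, tx, ty, tz]; ring
    rw [this]
    apply deg6
    rw [jac_coeff0, cx0, cy0, cz0]
    simp [ax, ay, az, bx, bY, bz, h, hw0, h2]

theorem QS.rigid [IsAlgClosed k] (D : Derivation k Q Q) (e : ℤ) (hD : ∀ h, ∃ n : ℕ, D^[n] h = 0)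
    (hhom : ∀ d h, h ∈ S.gr d → D h ∈ S.gr (d + e)) : D = 0 := by
  by_contra hne
  apply hne
  apply S.rigid_of_deg D hD
  obtain ⟨d, h, hd, hh⟩ : ∃ d h, h ∈ S.gr d ∧ D h ≠ 0 := by
    by_contra hcon
    push Not at hcon
    exact hne (S.der_ext (hcon _ _ S.x_mem) (hcon _ _ S.y_mem) (hcon _ _ S.z_mem) (hcon _ _ S.w_mem))
  obtain ⟨d, r, hd, hr1, hr2⟩ : ∃ d r, r ∈ S.gr d ∧ D r ≠ 0 ∧ D (D r) = 0 := by
    obtain ⟨n, hn⟩ := hD h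
    clear hne
    induction n generalizing d h with
    | zero => exact absurd (by rw [show h = 0 from hn, map_zero]) hh
    | succ n ih =>
      by_cases h1 : D (D h) = 0
      · exact ⟨d, h, hd, hh, h1⟩
      · exact ih _ _ (hhom _ _ hd) h1 hn
  have hdr := hhom _ _ hd
  have hrd : (ex D hD r).natDegree ≤ 1 := ex_deg_le D hD hr2
  have hr0 : r ≠ 0 := by rintro rfl; exact hr1 (map_zero _)
  rcases Int.even_or_odd d with h1 | h1
  · rcases Int.even_or_odd e with h2 | h2
    · have h3 := S.gr_odd (Odd.add_even (by decide) h2) (hhom _ _ S.w_mem)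
      have h4 := ex_dvd D hD h3
      exact ex_deg_le D hD (n := 1) (by simp [h4])
    · obtain ⟨g, hg⟩ := S.gr_odd (h1.add_odd h2) hdr
      have h3 := ex_deg_mul D hD (hg ▸ hr1)
      rw [← hg] at h3
      have h4 : (ex D hD (D r)).natDegree ≤ 0 := ex_deg_le D hD hr2
      omega
  · obtain ⟨g, hg⟩ := S.gr_odd h1 hd
    have h3 := ex_deg_mul D hD (hg ▸ hr0)
    rw [← hg] at h3
    omega

end rigid
section comps
open DirectSum
variable {k Q : Type} [Field k] [CommRing Q] [Algebra k Q] (S : QS k Q)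

theorem QS.hind {motive : Q → Prop} (q : Q) (zero : motive 0)
    (hom : ∀ n h, h ∈ S.gr n → motive h) (add : ∀ a b, motive a → motive b → motive (a + b)) :
    motive q :=
  DirectSum.Decomposition.inductionOn S.gr zero (fun m => hom _ _ m.2) add q

/-- projections -/
def QS.pr (n : ℤ) : Q →ₗ[k] Q where
  toFun q := (decompose S.gr q n : Q)
  map_add' a b := by simp
  map_smul' c a := by rw [decompose_smul]; rfl

theorem QS.pr_mem (n : ℤ) (q : Q) : S.pr n q ∈ S.gr n := (decompose S.gr q n).2

theorem QS.pr_same {n : ℤ} {q : Q} (h : q ∈ S.gr n) : S.pr n q = q := decompose_of_mem_same _ h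

theorem QS.pr_ne {n m : ℤ} {q : Q} (h : q ∈ S.gr n) (hm : n ≠ m) : S.pr m q = 0 :=
  decompose_of_mem_ne _ h hm

theorem QS.pr_mul {i : ℤ} (j : ℤ) {a : Q} (b : Q) (h : a ∈ S.gr i) :
    S.pr (i + j) (a * b) = a * S.pr j b := coe_decompose_mul_add_of_left_mem _ h

theorem QS.ex_sum (q : Q) : ∃ s : Finset ℤ, ∑ i ∈ s, S.pr i q = q ∧ ∀ i ∉ s, S.pr i q = 0 := by
  classical
  refine ⟨DFinsupp.support (decompose S.gr q), sum_support_decompose S.gr q, ?_⟩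
  intro i hi
  have := DFinsupp.notMem_support_iff.1 hi
  change ((decompose S.gr q i : S.gr i) : Q) = 0
  rw [this]; rfl

theorem QS.pr_ext {a b : Q} (h : ∀ n, S.pr n a = S.pr n b) : a = b := by
  apply (decompose S.gr).injective
  ext n
  exact h n

theorem QS.mem_of_pr {n : ℤ} {a : Q} (h : ∀ m, m ≠ n → S.pr m a = 0) : a ∈ S.gr n := by
  have : a = S.pr n a := by
    apply S.pr_ext
    intro m
    by_cases hm : m = n
    · subst hm; rw [S.pr_same (S.pr_mem m a)]
    · rw [h m hm, S.pr_ne (S.pr_mem n a) (Ne.symm hm)]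
  rw [this]; exact S.pr_mem _ _

theorem QS.ex_bound (q : Q) : ∃ M : ℤ, ∀ m > M, S.pr m q = 0 := by
  obtain ⟨s, -, hs⟩ := S.ex_sum q
  obtain ⟨M, hM⟩ := s.bddAbove
  refine ⟨M, fun m hm => hs m fun h => ?_⟩
  have := hM h
  omega

theorem QS.ex_lin (f : ℤ → Q →ₗ[k] Q) : ∃ L : Q →ₗ[k] Q, ∀ n h, h ∈ S.gr n → L h = f n h := by
  refine ⟨(DirectSum.toModule k ℤ Q (fun n => (f n).comp (S.gr n).subtype)).comp
    (decomposeLinearEquiv S.gr).toLinearMap, ?_⟩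
  intro n h hh
  simp only [LinearMap.comp_apply, LinearEquiv.coe_coe, decomposeLinearEquiv_apply]
  rw [decompose_of_mem _ hh]
  exact DirectSum.toModule_lof k n _

theorem QS.ex_der_of_hom (f : ℤ → Q →ₗ[k] Q) (hf : ∀ i j a b, a ∈ S.gr i → b ∈ S.gr j →
    f (i+j) (a*b) = a * f j b + b * f i a) :
    ∃ D : Derivation k Q Q, ∀ n h, h ∈ S.gr n → D h = f n h := by
  obtain ⟨L, hL⟩ := S.ex_lin f
  refine ⟨Derivation.mk' L ?_, hL⟩
  intro a b
  simp only [smul_eq_mul]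
  induction a using S.hind with
  | zero => simp
  | add a a' h h' => rw [add_mul, map_add, h, h', map_add]; ring
  | hom i a ha =>
    induction b using S.hind with
    | zero => simp
    | add a a' h h' => rw [mul_add, map_add, h, h', map_add]; ring
    | hom j b hb =>
      rw [hL _ _ (SetLike.mul_mem_graded ha hb), hL _ _ ha, hL _ _ hb, hf _ _ _ _ ha hb]

theorem QS.ex_comp (D : Derivation k Q Q) (e : ℤ) : ∃ D' : Derivation k Q Q,
    ∀ n h, h ∈ S.gr n → D' h = S.pr (n+e) (D h) := by
  refine S.ex_der_of_hom (fun n => (S.pr (n+e)).comp (D : Q →ₗ[k] Q)) ?_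
  intro i j a b ha hb
  simp only [LinearMap.comp_apply, Derivation.coeFn_coe, Derivation.leibniz, smul_eq_mul, map_add]
  rw [← S.pr_mul _ _ ha, ← S.pr_mul _ _ hb]
  congr 3 <;> ring_nf

/-- homogeneous component of a derivation -/
def QS.comp (D : Derivation k Q Q) (e : ℤ) : Derivation k Q Q := (S.ex_comp D e).choose

theorem QS.comp_apply (D : Derivation k Q Q) (e : ℤ) {n : ℤ} {h : Q} (hh : h ∈ S.gr n) :
    S.comp D e h = S.pr (n+e) (D h) := (S.ex_comp D e).choose_spec n h hh

theorem QS.comp_hom (D : Derivation k Q Q) (e : ℤ) (n : ℤ) (h : Q) (hh : h ∈ S.gr n) :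
    S.comp D e h ∈ S.gr (n + e) := by rw [S.comp_apply D e hh]; exact S.pr_mem _ _

theorem QS.ex_delta : ∃ D : Derivation k Q Q, ∀ (n : ℤ) h, h ∈ S.gr n → D h = (n : k) • h := by
  refine S.ex_der_of_hom (fun n => (n : k) • LinearMap.id) ?_
  intro i j a b ha hb
  change ((i + j : ℤ) : k) • (a*b) = a * ((j : k) • b) + b * ((i : k) • a)
  rw [Int.cast_add, Algebra.smul_def, Algebra.smul_def, Algebra.smul_def, map_add]
  ring

/-- Euler derivation -/
def QS.delta : Derivation k Q Q := S.ex_delta.choose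
theorem QS.delta_apply {n : ℤ} {h : Q} (hh : h ∈ S.gr n) : S.delta h = (n : k) • h :=
  S.ex_delta.choose_spec n h hh

theorem QS.pr_delta (n : ℤ) (q : Q) : S.pr n (S.delta q) = (n : k) • S.pr n q := by
  induction q using S.hind with
  | zero => simp
  | add a b ha hb => rw [map_add, map_add, ha, hb, map_add, smul_add]
  | hom m h hh =>
    rw [S.delta_apply hh, map_smul]
    by_cases hm : m = n
    · rw [hm]
    · rw [S.pr_ne hh hm]; simp

theorem QS.lnd_of_hom (D : Derivation k Q Q) (hD : ∀ n h, h ∈ S.gr n → ∃ j : ℕ, D^[j] h = 0) (q : Q) :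
    ∃ j : ℕ, D^[j] q = 0 := by
  induction q using S.hind with
  | zero => exact ⟨0, rfl⟩
  | hom n h hh => exact hD n h hh
  | add a b ha hb =>
    obtain ⟨i, hi⟩ := ha
    obtain ⟨j, hj⟩ := hb
    refine ⟨i + j, ?_⟩
    have : ∀ n : ℕ, D^[n] (a+b) = D^[n] a + D^[n] b := by
      intro n
      induction n with
      | zero => rfl
      | succ n ih => simp only [Function.iterate_succ_apply', ih, map_add]
    rw [this, iter_stay D hi (by omega), iter_stay D hj (by omega), add_zero]

theorem QS.iter_mem (D : Derivation k Q Q) (e : ℤ) (hhom : ∀ d h, h ∈ S.gr d → D h ∈ S.gr (d + e))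
    {d : ℤ} {h : Q} (hh : h ∈ S.gr d) (n : ℕ) : D^[n] h ∈ S.gr (d + n * e) := by
  induction n with
  | zero => simpa using hh
  | succ n ih =>
    rw [Function.iterate_succ_apply']
    have := hhom _ _ ih
    convert this using 2
    push_cast; ring

variable [CharZero k] [IsDomain Q] [IsAlgClosed k]

theorem QS.comp_neg (D : Derivation k Q Q) {e : ℤ} (he : e < 0) : S.comp D e = 0 := by
  apply S.rigid _ e _ (S.comp_hom D e)
  apply S.lnd_of_hom
  intro n h hh
  refine ⟨n.toNat + 1, S.gr_neg ?_ (S.iter_mem _ e (S.comp_hom D e) hh _)⟩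
  push_cast
  have : n ≤ (n.toNat : ℤ) := Int.self_le_toNat n
  nlinarith [Int.natCast_nonneg n.toNat]

theorem QS.pr_D (D : Derivation k Q Q) {e t : ℤ} (he : ∀ n > e, S.comp D n = 0) {q : Q}
    (hq : ∀ m > t, S.pr m q = 0) :
    (∀ m > t + e, S.pr m (D q) = 0) ∧ S.pr (t + e) (D q) = S.comp D e (S.pr t q) := by
  obtain ⟨s, hs, hs0⟩ := S.ex_sum q
  have key (m : ℤ) : S.pr m (D q) = ∑ i ∈ s, S.comp D (m - i) (S.pr i q) := by
    conv_lhs => rw [← hs, map_sum, map_sum]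
    apply Finset.sum_congr rfl
    intro i _
    rw [S.comp_apply D _ (S.pr_mem i q)]
    congr 2; ring
  constructor
  · intro m hm
    rw [key]
    apply Finset.sum_eq_zero
    intro i _
    by_cases hi : i > t
    · rw [hq i hi, map_zero]
    · rw [he (m - i) (by omega)]; rfl
  · rw [key, Finset.sum_eq_single t]
    · congr 2; ring
    · intro i _ hit
      by_cases hi : i > t
      · rw [hq i hi, map_zero]
      · rw [he _ (by omega)]; rfl
    · intro h; rw [hs0 t h, map_zero]

theorem QS.pr_iter (D : Derivation k Q Q) {e d : ℤ} (he : ∀ n > e, S.comp D n = 0) {h : Q}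
    (hh : h ∈ S.gr d) (n : ℕ) :
    (∀ m > d + n * e, S.pr m (D^[n] h) = 0) ∧ S.pr (d + n * e) (D^[n] h) = (S.comp D e)^[n] h := by
  induction n with
  | zero => 
    refine ⟨fun m hm => S.pr_ne hh ?_, ?_⟩
    · simp at hm; omega
    · simpa using S.pr_same hh
  | succ n ih =>
    obtain ⟨h1, h2⟩ := S.pr_D D he ih.1
    have e1 : d + ((n+1 : ℕ) : ℤ) * e = d + n * e + e := by push_cast; ring
    rw [e1, Function.iterate_succ_apply', Function.iterate_succ_apply', h2, ih.2]
    exact ⟨h1, rfl⟩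

/-- a derivation with uniformly bounded orbits has zero positive components -/
theorem QS.comp_pos (D : Derivation k Q Q)
    (hb : ∀ h, ∃ M : ℤ, ∀ (n : ℕ), ∀ m > M, S.pr m (D^[n] h) = 0) {e : ℤ} (he0 : 0 < e)
    (he : ∀ n > e, S.comp D n = 0) : S.comp D e = 0 := by
  apply S.rigid _ e _ (S.comp_hom D e)
  apply S.lnd_of_hom
  intro d h hh
  obtain ⟨M, hM⟩ := hb h
  refine ⟨(M - d).toNat + 1, ?_⟩
  rw [← (S.pr_iter D he hh _).2]
  apply hM
  push_cast
  have : M - d ≤ ((M-d).toNat : ℤ) := Int.self_le_toNat _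
  nlinarith [Int.natCast_nonneg (M-d).toNat]

theorem QS.comp_pos' (D : Derivation k Q Q)
    (hb : ∀ h, ∃ M : ℤ, ∀ (n : ℕ), ∀ m > M, S.pr m (D^[n] h) = 0) {e : ℤ} (he0 : 0 < e) :
    S.comp D e = 0 := by
  obtain ⟨N, hN⟩ : ∃ N : ℤ, ∀ n > N, S.comp D n = 0 := by
    obtain ⟨a, ha⟩ := S.ex_bound (D S.x)
    obtain ⟨b, hb⟩ := S.ex_bound (D S.y)
    obtain ⟨c, hc⟩ := S.ex_bound (D S.z)
    obtain ⟨d, hd⟩ := S.ex_bound (D S.w)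
    refine ⟨max (max a b) (max c d), fun n hn => S.der_ext ?_ ?_ ?_ ?_⟩
    · rw [S.comp_apply D n S.x_mem, ha _ (by omega)]; rfl
    · rw [S.comp_apply D n S.y_mem, hb _ (by omega)]; rfl
    · rw [S.comp_apply D n S.z_mem, hc _ (by omega)]; rfl
    · rw [S.comp_apply D n S.w_mem, hd _ (by omega)]; rfl
  have key : ∀ j : ℕ, ∀ n > max 0 (N - j), S.comp D n = 0 := by
    intro j
    induction j with
    | zero => intro n hn; exact hN n (by simp at hn; omega)
    | succ j ih =>
      intro n hn
      by_cases h : n > max 0 (N - j)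
      · exact ih n h
      · exact S.comp_pos D hb (by omega) fun m hm => ih m (by push_cast at hn; omega)
  exact key N.toNat e (by omega)

theorem QS.degree_zero (D : Derivation k Q Q)
    (hb : ∀ h, ∃ M : ℤ, ∀ (n : ℕ), ∀ m > M, S.pr m (D^[n] h) = 0) {d : ℤ} {h : Q} (hh : h ∈ S.gr d) :
    D h ∈ S.gr d := by
  apply S.mem_of_pr
  intro m hm
  have h1 := S.comp_apply D (m - d) hh
  rw [add_sub_cancel] at h1
  rw [← h1]
  rcases lt_or_gt_of_ne hm with h2 | h2
  · rw [S.comp_neg D (by omega)]; rfl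
  · rw [S.comp_pos' D hb (by omega)]; rfl

/-- conjugated Euler derivation -/
def QS.conj (f : Q ≃ₐ[k] Q) : Derivation k Q Q :=
  Derivation.mk' (f.toLinearMap ∘ₗ (S.delta : Q →ₗ[k] Q) ∘ₗ f.symm.toLinearMap) (by
    intro a b
    simp [mul_comm])

theorem QS.conj_apply (f : Q ≃ₐ[k] Q) (q : Q) : S.conj f q = f (S.delta (f.symm q)) := rfl

theorem QS.conj_iter (f : Q ≃ₐ[k] Q) (n : ℕ) (q : Q) : (S.conj f)^[n] q = f (S.delta^[n] (f.symm q)) := by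
  induction n with
  | zero => simp
  | succ n ih => simp only [Function.iterate_succ_apply', ih, S.conj_apply, AlgEquiv.symm_apply_apply]

theorem QS.conj_bd (f : Q ≃ₐ[k] Q) (q : Q) :
    ∃ M : ℤ, ∀ (n : ℕ), ∀ m > M, S.pr m ((S.conj f)^[n] q) = 0 := by
  suffices ∀ r : Q, ∃ M : ℤ, ∀ (n : ℕ), ∀ m > M, S.pr m (f (S.delta^[n] r)) = 0 by
    obtain ⟨M, hM⟩ := this (f.symm q)
    exact ⟨M, fun n m hm => by rw [S.conj_iter, hM n m hm]⟩
  intro r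
  induction r using S.hind with
  | zero => exact ⟨0, fun n m _ => by rw [iter_zero]; simp⟩
  | hom d h hh => 
    obtain ⟨M, hM⟩ := S.ex_bound (f h)
    refine ⟨M, fun n m hm => ?_⟩
    have : S.delta^[n] h = ((d:k)^n) • h := by
      induction n with
      | zero => simp
      | succ n ih => rw [Function.iterate_succ_apply', ih, Derivation.map_smul, S.delta_apply hh, smul_smul, pow_succ]
    rw [this, map_smul, map_smul, hM m hm, smul_zero]
  | add a b ha hb => 
    obtain ⟨i, hi⟩ := ha
    obtain ⟨j, hj⟩ := hb
    refine ⟨max i j, fun n m hm => ?_⟩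
    have : S.delta^[n] (a+b) = S.delta^[n] a + S.delta^[n] b := by
      induction n with
      | zero => rfl
      | succ n ih => simp only [Function.iterate_succ_apply', ih, map_add]
    rw [this, map_add, map_add, hi _ _ (by omega), hj _ _ (by omega), add_zero]

theorem QS.conj_deg (f : Q ≃ₐ[k] Q) {d : ℤ} {h : Q} (hh : h ∈ S.gr d) : S.conj f h ∈ S.gr d :=
  S.degree_zero _ (S.conj_bd f) hh

end comps
section final
variable {k Q : Type} [Field k] [CommRing Q] [Algebra k Q] [CharZero k]

theorem poly3 {a b c d : k} (h : ∀ x : k, a*x^3+b*x^2+c*x+d = 0) : a = 0 ∧ b = 0 ∧ c = 0 ∧ d = 0 := by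
  have h0 := h 0
  have h1 := h 1
  have h2 := h (-1)
  have h3 := h 2
  refine ⟨?_, ?_, ?_, ?_⟩ <;> grind

theorem poly4 {a b c d e : k} (h : ∀ x : k, a*x^4+b*x^3+c*x^2+d*x+e = 0) :
    a = 0 ∧ b = 0 ∧ c = 0 ∧ d = 0 ∧ e = 0 := by
  have h0 := h 0
  have h1 := h 1
  have h2 := h (-1)
  have h3 := h 2
  have h4 := h (-2)
  refine ⟨?_, ?_, ?_, ?_, ?_⟩ <;> grind

/-- infinitesimal symmetries of `F` -/
theorem inf_sym {g g' g'' b b' a w : k} (h : ∀ x y : k,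
    (2*x-2*y^2-144*x*y+8*y^3-1296*x^2) * (g*x+g'*y+g'')
    + (-4*x*y+4*y^3-72*x^2+24*x*y^2) * (b*y+b') + (3*x^2-4*x*y^2+y^4-72*x^2*y) * a
    = 2 * w * FF x y 1) :
    b' = 0 ∧ g' = 0 ∧ g'' = 0 ∧ g = 3 * a ∧ b = 2 * a ∧ 2 * w = 9 * a := by
  have h1 (y : k) := poly3 (k := k) (a := -1296*g + 864 * w)
    (b := (2-144*y)*g - 1296*(g'*y+g'') - 72*(b*y+b') + (3-72*y)*a - 2*w*(1-72*y))
    (c := (-2*y^2+8*y^3)*g + (2-144*y)*(g'*y+g'') + (-4*y+24*y^2)*(b*y+b') -4*y^2*a - 2*w*(-2*y^2+8*y^3))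
    (d := (-2*y^2+8*y^3)*(g'*y+g'') + 4*y^3*(b*y+b') + y^4*a - 2*w*y^4) (fun x => by
      have := h x y
      simp only [FF] at this
      linear_combination this)
  have e1 := (h1 0).1
  obtain ⟨-, -, -, e2, e3⟩ := poly4 (k := k) (a := 0) (b := 0) (c := 0)
    (d := -144*g-1296*g'-72*b-72*a+144*w) (e := 2*g-1296*g''-72*b'+3*a-2*w) (fun y => by
      linear_combination (h1 y).2.1)
  obtain ⟨e4, e5, e6, -, -⟩ := poly4 (k := k) (a := 8*g'+4*b+a-2*w) (b := -2*g'+8*g''+4*b')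
    (c := -2*g'') (d := 0) (e := 0) (fun y => by
      linear_combination (h1 y).2.2.2)
  obtain ⟨-, e7, e8, e9, e10⟩ := poly4 (k := k) (a := 0) (b := 8*g+24*b-16*w)
    (c := -2*g-144*g'-4*b+24*b'-4*a+4*w)
    (d := 2*g'-144*g''-4*b') (e := 2*g'') (fun y => by
      linear_combination (h1 y).2.2.1)
  clear h h1
  refine ⟨?_, ?_, ?_, ?_, ?_, ?_⟩ <;> grind

/-- symmetries of `F` -/
theorem fin_sym {g g' g'' b b' a w : k} (hb : b ≠ 0) (hg : g ≠ 0) (ha : a ≠ 0) (h : ∀ x y : k,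
    FF (g*x+g'*y+g'') (b*y+b') a = w^2 * FF x y 1) :
    b' = 0 ∧ g' = 0 ∧ g'' = 0 ∧ g = a^3 ∧ b = a^2 ∧ w^2 = a^9 := by
  have h1 (y : k) := poly3 (k := k) (a := -432*g^3+432*w^2)
    (b := g^2 * (a^3-72*(b*y+b')*a-1296*(g'*y+g''))-w^2*(1-72*y))
    (c := g * (2*(g'*y+g'')*(a^3-72*(b*y+b')*a)-2*(b*y+b')^2*a^2+8*(b*y+b')^3-1296*(g'*y+g'')^2)
      - w^2*(-2*y^2+8*y^3))
    (d := FF (g'*y+g'') (b*y+b') a - w^2*y^4) (fun x => by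
      have := h x y
      simp only [FF] at this ⊢
      linear_combination this)
  have e1 := (h1 0).1
  obtain ⟨-, -, -, e2, e3⟩ := poly4 (k := k) (a := 0) (b := 0) (c := 0)
    (d := g^2*(-72*b*a-1296*g')+72*w^2) (e := g^2*(a^3-72*b'*a-1296*g'')-w^2) (fun y => by
      linear_combination (h1 y).2.1)
  obtain ⟨-, e7, -, -, -⟩ := poly4 (k := k) (a := 0) (b := 8*g*b^3-8*w^2)
    (c := g*(-144*g'*b*a-2*b^2*a^2+24*b^2*b'-1296*g'^2) + 2*w^2)
    (d := g*(2*g'*(a^3-72*b'*a)-144*g''*b*a-4*b*b'*a^2+24*b*b'^2-2592*g'*g''))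
    (e := g*(2*g''*(a^3-72*b'*a)-2*b'^2*a^2+8*b'^3-1296*g''^2)) (fun y => by
      linear_combination (h1 y).2.2.1)
  have hw : w^2 = g^3 := by grind
  have hgb : g^2 = b^3 := by
    apply mul_left_cancel₀ hg
    grind
  have h18 : b * a + 18 * g' = g := by
    apply mul_left_cancel₀ (pow_ne_zero 2 hg)
    grind
  obtain ⟨e4, -, -, -, -⟩ := poly4 (k := k) (a := b^4*a+8*g'*b^3-w^2)
    (b := -2*g'*b^2*a^2+4*b^3*b'*a-72*g'^2*b*a+8*g''*b^3+24*g'*b^2*b'-432*g'^3)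
    (c := g'^2*a^3 - 2*a^2*(2*g'*b*b'+g''*b^2) + 6*b^2*b'^2*a - 72*a*(g'^2*b'+2*g'*g''*b)
      + 8*(3*g'*b*b'^2+3*g''*b^2*b') - 1296*g'^2*g'')
    (d := 2*g'*g''*a^3 - 2*a^2*(g'*b'^2+2*g''*b*b') + 4*b*b'^3*a-72*a*(2*g'*g''*b'+g''^2*b)
      + 8*(g'*b'^3+3*g''*b*b'^2) - 1296*g'*g''^2)
    (e := FF g'' b' a) (fun y => by
      have := (h1 y).2.2.2
      simp only [FF] at this ⊢
      linear_combination this)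
  have h8 : b * a + 8 * g' = g := by
    apply mul_left_cancel₀ (pow_ne_zero 3 hb)
    grind
  have hg' : g' = 0 := by grind
  subst hg'
  have hga : g = b * a := by grind
  have hba : b = a^2 := by
    apply mul_left_cancel₀ (pow_ne_zero 2 hb)
    grind
  subst hba
  subst hga
  have h2 : -72*b'*a-1296*g''=0 := by
    have : (a^2*a)^2*(-72*b'*a-1296*g'')=0 := by linear_combination e3 + hw
    exact (mul_eq_zero.1 this).resolve_left (pow_ne_zero 2 hg)
  have h3 : 4*b'*a+8*g''=0 := by
    obtain ⟨-, e5, -, -, -⟩ := poly4 (k := k) (a := 0) (b := (a^2)^3*(4*b'*a+8*g''))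
      (c := - 2*a^2*(g''*(a^2)^2) + 6*(a^2)^2*b'^2*a 
      + 8*(3*g''*(a^2)^2*b'))
      (d := - 2*a^2*(2*g''*(a^2)*b') + 4*(a^2)*b'^3*a-72*a*(g''^2*(a^2))
        + 8*(3*g''*(a^2)*b'^2))
      (e := FF g'' b' a) (fun y => by
        have := (h1 y).2.2.2
        simp only [FF] at this ⊢
        linear_combination this + y^4 * hw)
    exact (mul_eq_zero.1 e5).resolve_left (pow_ne_zero 3 hb)
  have hg'' : g'' = 0 := by grind
  have hb' : b' = 0 := by
    have : a * b' = 0 := by grind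
    exact (mul_eq_zero.1 this).resolve_left ha
  exact ⟨hb', rfl, hg'', by ring, rfl, by rw [hw]; ring⟩

end final

section autgroup
variable {k Q : Type} [Field k] [CommRing Q] [Algebra k Q] (S : QS k Q)

theorem der_FF (D : Derivation k Q Q) (x y z : Q) :
    D (FF x y z) = (2*x*z^3-2*y^2*z^2-144*x*y*z+8*y^3-1296*x^2)*D x
      + (-4*x*y*z^2+4*y^3*z-72*x^2*z+24*x*y^2)*D y
      + (3*x^2*z^2-4*x*y^2*z+y^4-72*x^2*y)*D z := by
  have e2 : D 2 = 0 := by exact_mod_cast D.map_natCast 2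
  have e8 : D 8 = 0 := by exact_mod_cast D.map_natCast 8
  have e72 : D 72 = 0 := by exact_mod_cast D.map_natCast 72
  have e432 : D 432 = 0 := by exact_mod_cast D.map_natCast 432
  simp only [FF, map_sub, map_add, Derivation.leibniz, Derivation.leibniz_pow, smul_eq_mul,
    e2, e8, e72, e432, nsmul_eq_mul]
  push_cast
  ring

theorem QS.der_rel (D : Derivation k Q Q) :
    2 * S.w * D S.w = (2*S.x*S.z^3-2*S.y^2*S.z^2-144*S.x*S.y*S.z+8*S.y^3-1296*S.x^2)*D S.x
      + (-4*S.x*S.y*S.z^2+4*S.y^3*S.z-72*S.x^2*S.z+24*S.x*S.y^2)*D S.y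
      + (3*S.x^2*S.z^2-4*S.x*S.y^2*S.z+S.y^4-72*S.x^2*S.y)*D S.z := by
  rw [← der_FF, ← S.rel, Derivation.leibniz_pow]
  simp only [smul_eq_mul, nsmul_eq_mul]
  push_cast
  ring

/-- the torus action -/
theorem QS.ex_tor (t : k) : ∃ f : Q →ₐ[k] Q, f S.x = t^6 • S.x ∧ f S.y = t^4 • S.y ∧
    f S.z = t^2 • S.z ∧ f S.w = t^9 • S.w := by
  apply S.lift
  have := S.rel
  simp only [FF, Algebra.smul_def, map_pow] at this ⊢
  linear_combination (algebraMap k Q t)^18 * this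

/-- the torus action -/
def QS.tor (t : k) : Q →ₐ[k] Q := (S.ex_tor t).choose
theorem QS.tor_x (t : k) : S.tor t S.x = t^6 • S.x := (S.ex_tor t).choose_spec.1
theorem QS.tor_y (t : k) : S.tor t S.y = t^4 • S.y := (S.ex_tor t).choose_spec.2.1
theorem QS.tor_z (t : k) : S.tor t S.z = t^2 • S.z := (S.ex_tor t).choose_spec.2.2.1
theorem QS.tor_w (t : k) : S.tor t S.w = t^9 • S.w := (S.ex_tor t).choose_spec.2.2.2

theorem QS.tor_mul (s t : k) : S.tor (s * t) = (S.tor s).comp (S.tor t) := by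
  apply S.hom_ext <;>
    simp only [AlgHom.comp_apply, S.tor_x, S.tor_y, S.tor_z, S.tor_w, map_smul, smul_smul] <;>
    congr 1 <;> ring

theorem QS.tor_one : S.tor (1 : k) = AlgHom.id k Q := by
  apply S.hom_ext <;>
    simp [S.tor_x, S.tor_y, S.tor_z, S.tor_w]

/-- the torus action by automorphisms -/
def QS.torE : kˣ →* (Q ≃ₐ[k] Q) where
  toFun t := AlgEquiv.ofAlgHom (S.tor (t : k)) (S.tor ((t⁻¹ : kˣ) : k))
    (by rw [← S.tor_mul]; simp [S.tor_one]) (by rw [← S.tor_mul]; simp [S.tor_one])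
  map_one' := by
    ext q
    simp [S.tor_one]
  map_mul' s t := by
    ext q
    simp [S.tor_mul]

theorem QS.torE_apply (t : kˣ) (q : Q) : S.torE t q = S.tor (t : k) q := rfl

variable [CharZero k] [IsDomain Q] [IsAlgClosed k]

theorem QS.z_ne : S.z ≠ 0 := by
  intro h
  obtain ⟨f, d, -, -, -, hz, -⟩ := S.ex_point 0 0 1
  rw [h, map_zero] at hz
  exact zero_ne_one hz

theorem smul_inj {q : Q} (hq : q ≠ 0) {a b : k} (h : a • q = b • q) : a = b := by
  rw [Algebra.smul_def, Algebra.smul_def] at h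
  exact (algebraMap k Q).injective (mul_right_cancel₀ hq h)

theorem QS.torE_inj : Function.Injective S.torE := by
  rw [injective_iff_map_eq_one]
  intro t ht
  have h1 : S.tor (t : k) S.z = S.z := by rw [← S.torE_apply, ht]; rfl
  have h2 : S.tor (t : k) S.w = S.w := by rw [← S.torE_apply, ht]; rfl
  rw [S.tor_z] at h1
  rw [S.tor_w] at h2
  have h1 : (t : k)^2 = 1 := smul_inj S.z_ne (by rw [h1, one_smul])
  have h2 : (t : k)^9 = 1 := smul_inj S.w_ne (by rw [h2, one_smul])
  ext
  push_cast
  linear_combination h2 - (t * (t^6 + t^4 + t^2 + 1) : k) * h1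

theorem QS.conj_eq (f : Q ≃ₐ[k] Q) : ∃ c : k, S.conj f = c • S.delta := by
  obtain ⟨a, ha⟩ := S.gr_two (S.conj_deg f S.z_mem)
  obtain ⟨b, b', hb⟩ := S.gr_four (S.conj_deg f S.y_mem)
  obtain ⟨g, g', g'', hg⟩ := S.gr_six (S.conj_deg f S.x_mem)
  obtain ⟨w, hw⟩ := S.gr_nine (S.conj_deg f S.w_mem)
  have hrel := S.der_rel (S.conj f)
  rw [ha, hb, hg, hw] at hrel
  obtain ⟨h1, h2, h3, h4, h5, h6⟩ := inf_sym (g := g) (g' := g') (g'' := g'') (b := b) (b' := b')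
    (a := a) (w := w) (fun x y => by
      obtain ⟨f, d, hd, fx, fy, fz, fw⟩ := S.ex_point x y 1
      have := congrArg f hrel
      simp only [map_mul, map_add, map_sub, map_neg, map_pow, map_smul, map_ofNat, fx, fy, fz, fw,
        smul_eq_mul] at this
      rw [← hd]
      linear_combination - this)
  subst h1 h2 h3 h4 h5
  refine ⟨a / 2, S.der_ext ?_ ?_ ?_ ?_⟩
  · rw [hg, Derivation.smul_apply, S.delta_apply S.x_mem, smul_smul]
    simp only [zero_smul, add_zero]
    congr 1; push_cast; ring
  · rw [hb, Derivation.smul_apply, S.delta_apply S.y_mem, smul_smul]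
    simp only [zero_smul, add_zero]
    congr 1; push_cast; ring
  · rw [ha, Derivation.smul_apply, S.delta_apply S.z_mem, smul_smul]
    congr 1; push_cast; ring
  · rw [hw, Derivation.smul_apply, S.delta_apply S.w_mem, smul_smul]
    congr 1; push_cast; linear_combination h6 / 2

theorem QS.eig {q : Q} (hq : q ≠ 0) {l : k} (h : S.delta q = l • q) :
    ∃ n : ℤ, (n : k) = l ∧ (n = 0 ∨ 2 ≤ n) := by
  have : ∃ n, S.pr n q ≠ 0 := by
    by_contra! hc
    exact hq (S.pr_ext fun n => by rw [hc, map_zero])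
  obtain ⟨n, hn⟩ := this
  refine ⟨n, ?_, ?_⟩
  · have h1 := S.pr_delta n q
    rw [h, map_smul] at h1
    exact (smul_inj hn h1).symm
  · by_contra hc
    have h1 : n < 0 ∨ n = 1 := by omega
    rcases h1 with h1 | rfl
    · exact hn (S.gr_neg h1 (S.pr_mem _ _))
    · exact hn (S.gr_one (S.pr_mem _ _))

theorem QS.comm_delta (f : Q ≃ₐ[k] Q) (q : Q) : f (S.delta q) = S.delta (f q) := by
  obtain ⟨c, hc⟩ := S.conj_eq f
  have h (q : Q) : f (S.delta q) = c • S.delta (f q) := by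
    have := S.conj_apply f (f q)
    rw [hc] at this
    simpa using this.symm
  have hz := S.delta_apply S.z_mem
  have hc0 : c ≠ 0 := by
    rintro rfl
    have := h S.z
    rw [hz, zero_smul, map_smul] at this
    have h2 : f S.z ≠ 0 := by simpa using S.z_ne
    have := smul_inj h2 (this.trans (zero_smul k _).symm)
    norm_num at this
  obtain ⟨n, hn, hn'⟩ := S.eig (q := f S.z) (l := 2 / c) (by simpa using S.z_ne) (by
    have := h S.z
    rw [hz, map_smul] at this
    have h2 := congrArg (fun q => c⁻¹ • q) this
    simp only [smul_smul, inv_mul_cancel₀ hc0, one_smul] at h2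
    rw [← h2]
    congr 1; push_cast; ring)
  obtain ⟨m, hm, hm'⟩ := S.eig (q := f.symm S.z) (l := 2 * c) (by simpa using S.z_ne) (by
    apply f.injective
    rw [h, map_smul, f.apply_symm_apply, hz, smul_smul]
    congr 1; push_cast; ring)
  have hmn : m * n = 4 := by
    have : ((m * n : ℤ) : k) = ((4 : ℤ) : k) := by
      push_cast; rw [hm, hn]; field_simp; norm_num
    exact_mod_cast this
  have hm2 : m = 2 := by
    rcases hn' with rfl | hn'
    · omega
    rcases hm' with rfl | hm'
    · omega
    nlinarith
  have : c = 1 := by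
    subst hm2
    push_cast at hm
    linear_combination - hm / 2
  rw [h, this, one_smul]

theorem QS.aut_mem (f : Q ≃ₐ[k] Q) {n : ℤ} {q : Q} (hq : q ∈ S.gr n) : f q ∈ S.gr n := by
  apply S.mem_of_pr
  intro m hm
  have h1 := S.comm_delta f q
  rw [S.delta_apply hq, map_smul] at h1
  have h2 := S.pr_delta m (f q)
  rw [← h1, map_smul] at h2
  by_contra hc
  have := smul_inj hc h2
  exact hm (by exact_mod_cast this.symm)

theorem QS.torE_surj : Function.Surjective S.torE := by
  intro f
  obtain ⟨a, ha⟩ := S.gr_two (S.aut_mem f S.z_mem)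
  obtain ⟨b, b', hb⟩ := S.gr_four (S.aut_mem f S.y_mem)
  obtain ⟨g, g', g'', hg⟩ := S.gr_six (S.aut_mem f S.x_mem)
  obtain ⟨w, hw⟩ := S.gr_nine (S.aut_mem f S.w_mem)
  have ha0 : a ≠ 0 := by
    rintro rfl
    rw [zero_smul] at ha
    exact S.z_ne (by simpa using ha)
  have hb0 : b ≠ 0 := by
    rintro rfl
    have : a^2 • S.y - b' • S.z^2 = 0 := by
      apply f.injective
      rw [map_zero, map_sub, map_smul, map_smul, map_pow, ha, hb]
      simp only [Algebra.smul_def, map_pow, map_zero]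
      ring
    obtain ⟨p, d, -, -, py, pz, -⟩ := S.ex_point 0 1 0
    have := congrArg p this
    simp [py, pz] at this
    exact ha0 this
  have hg0 : g ≠ 0 := by
    rintro rfl
    have : (a^3*b) • S.x - (g' * a^2) • (S.y * S.z) - (b*g'' - g' * b') • S.z^3 = 0 := by
      apply f.injective
      simp only [map_zero, map_sub, map_smul, map_pow, map_mul, ha, hb, hg]
      simp only [Algebra.smul_def, map_pow, map_zero, map_mul, map_sub]
      ring
    obtain ⟨p, d, -, px, py, pz, -⟩ := S.ex_point 1 0 0
    have := congrArg p this
    simp [px, py, pz] at this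
    tauto
  have hrel := congrArg f S.rel
  have e := map_FF (f : Q →+* Q) S.x S.y S.z
  simp only [RingHom.coe_coe] at e
  rw [e, map_pow, ha, hb, hg, hw] at hrel
  obtain ⟨h1, h2, h3, h4, h5, h6⟩ := fin_sym (g := g) (g' := g') (g'' := g'') (b := b) (b' := b')
    (a := a) (w := w) hb0 hg0 ha0 (fun x y => by
      obtain ⟨f, d, hd, fx, fy, fz, fw⟩ := S.ex_point x y 1
      have := congrArg f hrel
      have e := map_FF (f : Q →+* k)
      simp only [RingHom.coe_coe] at e
      simp only [e, map_mul, map_add, map_pow, map_smul, fx, fy, fz, fw,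
        smul_eq_mul, one_pow, mul_one] at this
      rw [← hd, ← this]
      ring)
  subst h1 h2 h3 h4 h5
  have hw0 : w ≠ 0 := by
    rintro rfl
    exact ha0 (by simpa using h6.symm)
  have t2 : (w / a^4)^2 = a := by
    rw [div_pow, h6]; field_simp
  refine ⟨Units.mk0 (w / a^4) (div_ne_zero hw0 (pow_ne_zero _ ha0)), ?_⟩
  have key : S.tor (w / a^4) = (f : Q →ₐ[k] Q) := by
    apply S.hom_ext
    · rw [S.tor_x]
      refine Eq.trans ?_ hg.symm
      simp only [zero_smul, add_zero]
      congr 1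
      exact (pow_mul (w / a^4) 2 3).trans (by rw [t2])
    · rw [S.tor_y]
      refine Eq.trans ?_ hb.symm
      simp only [zero_smul, add_zero]
      congr 1
      exact (pow_mul (w / a^4) 2 2).trans (by rw [t2])
    · rw [S.tor_z]
      refine Eq.trans ?_ ha.symm
      rw [t2]
    · rw [S.tor_w]
      refine Eq.trans ?_ hw.symm
      congr 1
      have : (w / a^4)^9 = ((w / a^4)^2)^4 * (w / a^4) := by ring
      rw [this, t2]; field_simp
  ext q
  rw [S.torE_apply]
  exact DFunLike.congr_fun key q

end autgroup

/-- Corollary 1.4 (cor1): the group of `k`-algebra automorphisms of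
`Q = R[W]/(W² - F)` is isomorphic to `k*`. -/
theorem statement_3 (k : Type) [Field k] [IsAlgClosed k] [CharZero k] :
    Nonempty (kˣ ≃* (QuinticInvariantRing k ≃ₐ[k] QuinticInvariantRing k)) := by
  have := (theQS k).isDomain
  exact ⟨MulEquiv.ofBijective (theQS k).torE ⟨(theQS k).torE_inj, (theQS k).torE_surj⟩⟩
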